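/- arXiv:math/0412214 — 3 statements merged into one kernel-verified Lean document; each statement's English description precedes it below -/
import Mathlib

section
/- Let (W,S) be an irreducible Coxeter system with W infinite, and let w ∈ W. Then w is essential if and only if W is generated by the set {r_β : β ∈ Φ⁺ and β is w-odd}, where for β = uα_s ∈ Φ the reflection r_β is defined as usu⁻¹ (equivalently, r_β acts on V by r_β(x) = x − 2⟨x,β⟩β). -/
/-!
Statement 4 (Krammer): Let (W,S) be an irreducible Coxeter system with W infinite, and let
w ∈ W. Then w is essential if and only if W is generated by the set
{r_β : β ∈ Φ⁺ and β is w-odd}, where for β = u α_s ∈ Φ the reflection r_β is u s u⁻¹.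
-/

noncomputable section

namespace CoxeterPaper

variable {B : Type*}

/-- The entry `⟨α_s, α_t⟩` of the canonical bilinear form: `-cos (π / m_{s,t})` if
`m_{s,t} < ∞`, and `-1` if `m_{s,t} = ∞` (encoded by `M s t = 0`). -/
noncomputable def formEntry (M : CoxeterMatrix B) (s t : B) : ℝ :=
  if M s t = 0 then -1 else -Real.cos (Real.pi / (M s t : ℝ))

/-- The canonical bilinear form on `V = ⊕_{s ∈ S} ℝ α_s`, identified with `B → ℝ` via the
basis of simple roots. -/
noncomputable def canonicalForm [Fintype B] (M : CoxeterMatrix B) (x y : B → ℝ) : ℝ :=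
  ∑ s, ∑ t, x s * y t * formEntry M s t

/-- The simple root `α_s`, i.e. the `s`-th standard basis vector of `B → ℝ`. -/
def simpleRoot [DecidableEq B] (s : B) : B → ℝ := Pi.single s 1

variable [Fintype B] [DecidableEq B] {W : Type*} [Group W] {M : CoxeterMatrix B}

/-- `v` belongs to the root system `Φ = {w α_s : w ∈ W, s ∈ S}` (with respect to the
canonical representation `ρ`). -/
def IsRoot (ρ : W →* ((B → ℝ) ≃ₗ[ℝ] (B → ℝ))) (v : B → ℝ) : Prop :=
  ∃ (w : W) (s : B), v = ρ w (simpleRoot s)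

/-- `v` is positive: all its coordinates in the basis of simple roots are nonnegative. -/
def IsPos (v : B → ℝ) : Prop := ∀ t, 0 ≤ v t

/-- `v` is negative: `-v` is positive. -/
def IsNeg (v : B → ℝ) : Prop := IsPos (-v)

/-- The root `α` separates `u` and `v`: there is `ε ∈ {±1}` with `u α ∈ Φ^ε` and
`v α ∈ Φ^{-ε}`. -/
def Separates (ρ : W →* ((B → ℝ) ≃ₗ[ℝ] (B → ℝ))) (α : B → ℝ) (u v : W) : Prop :=
  (IsPos (ρ u α) ∧ IsNeg (ρ v α)) ∨ (IsNeg (ρ u α) ∧ IsPos (ρ v α))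

/-- The set `{m ∈ ℤ : α separates w^m and w^{m+1}}`. -/
def sepSet (ρ : W →* ((B → ℝ) ≃ₗ[ℝ] (B → ℝ))) (w : W) (α : B → ℝ) : Set ℤ :=
  {m : ℤ | Separates ρ α (w ^ m) (w ^ (m + 1))}

/-- `α` is `w`-periodic: `w^m α = α` for some `m ≥ 1`. -/
def IsPeriodic (ρ : W →* ((B → ℝ) ≃ₗ[ℝ] (B → ℝ))) (w : W) (α : B → ℝ) : Prop :=
  ∃ m : ℕ, 1 ≤ m ∧ ρ (w ^ m) α = α

/-- `α` is `w`-even: not `w`-periodic, and the set `{m ∈ ℤ : α separates w^m and w^{m+1}}`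
is finite of even cardinality. -/
def IsWEven (ρ : W →* ((B → ℝ) ≃ₗ[ℝ] (B → ℝ))) (w : W) (α : B → ℝ) : Prop :=
  ¬ IsPeriodic ρ w α ∧ (sepSet ρ w α).Finite ∧ Even (sepSet ρ w α).ncard

/-- `α` is `w`-odd: not `w`-periodic, and the set `{m ∈ ℤ : α separates w^m and w^{m+1}}`
is finite of odd cardinality. -/
def IsWOdd (ρ : W →* ((B → ℝ) ≃ₗ[ℝ] (B → ℝ))) (w : W) (α : B → ℝ) : Prop :=
  ¬ IsPeriodic ρ w α ∧ (sepSet ρ w α).Finite ∧ Odd (sepSet ρ w α).ncard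

/-- The Coxeter graph of `M`: vertex set `B`, with `s, t` joined by an edge iff `m_{s,t} ≥ 3`
(where `m_{s,t} = ∞` is encoded by `M s t = 0`). -/
def coxeterGraph (M : CoxeterMatrix B) : SimpleGraph B :=
  SimpleGraph.fromRel (fun s t => M s t = 0 ∨ 3 ≤ M s t)

/-- The standard parabolic subgroup `W_X`, generated by the simple reflections indexed by `X`. -/
def standardParabolic {M : CoxeterMatrix B} (cs : CoxeterSystem M W) (X : Set B) : Subgroup W :=
  Subgroup.closure (cs.simple '' X)

/-- A parabolic subgroup of `W`: a conjugate `w W_X w⁻¹` of a standard parabolic subgroup. -/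
def IsParabolic {M : CoxeterMatrix B} (cs : CoxeterSystem M W) (P : Subgroup W) : Prop :=
  ∃ (w : W) (X : Set B), P = (standardParabolic cs X).map (MulAut.conj w).toMonoidHom

/-- `w` is essential: it does not lie in any proper parabolic subgroup of `W`. -/
def IsEssential {M : CoxeterMatrix B} (cs : CoxeterSystem M W) (w : W) : Prop :=
  ∀ P : Subgroup W, IsParabolic cs P → P ≠ ⊤ → w ∉ P

section

set_option linter.unusedSectionVars false

/-! ### The canonical form -/

lemma formEntry_comm (M : CoxeterMatrix B) (s t : B) : formEntry M s t = formEntry M t s := by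
  simp only [formEntry, M.symmetric s t]

lemma formEntry_self (M : CoxeterMatrix B) (s : B) : formEntry M s s = 1 := by
  simp [formEntry]

lemma formEntry_nonpos (M : CoxeterMatrix B) {s t : B} (h : s ≠ t) : formEntry M s t ≤ 0 := by
  unfold formEntry
  split_ifs with h0
  · norm_num
  · have h1 := M.off_diagonal s t h
    have h2 : (2 : ℝ) ≤ M s t := by exact_mod_cast (show 2 ≤ M s t by omega)
    have : 0 ≤ Real.cos (Real.pi / M s t) := by
      apply Real.cos_nonneg_of_neg_pi_div_two_le_of_le
      · have : 0 ≤ Real.pi / M s t := by positivity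
        linarith [Real.pi_pos]
      · exact div_le_div_of_nonneg_left Real.pi_pos.le (by norm_num) h2
    linarith

/-- Orthogonal simple roots have commuting reflections. -/
lemma eq_two_of_formEntry_eq_zero (M : CoxeterMatrix B) {s t : B} (h : formEntry M s t = 0) :
    M s t = 2 := by
  have hst : s ≠ t := by
    rintro rfl
    rw [formEntry_self] at h
    norm_num at h
  have h1 := M.off_diagonal s t hst
  unfold formEntry at h
  split_ifs at h with h0
  · norm_num at h
  by_contra h2
  have h3 : (3 : ℝ) ≤ M s t := by exact_mod_cast (show 3 ≤ M s t by omega)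
  have : 0 < Real.cos (Real.pi / M s t) := by
    apply Real.cos_pos_of_mem_Ioo
    constructor
    · have : 0 ≤ Real.pi / M s t := by positivity
      linarith [Real.pi_pos]
    · have : Real.pi / M s t ≤ Real.pi / 3 :=
        div_le_div_of_nonneg_left Real.pi_pos.le (by norm_num) h3
      linarith [Real.pi_pos]
  linarith

lemma canonicalForm_comm (M : CoxeterMatrix B) (x y : B → ℝ) :
    canonicalForm M x y = canonicalForm M y x := by
  unfold canonicalForm
  rw [Finset.sum_comm]
  refine Finset.sum_congr rfl fun s _ => Finset.sum_congr rfl fun t _ => ?_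
  rw [formEntry_comm M s t]
  ring

lemma canonicalForm_add_left (M : CoxeterMatrix B) (x y z : B → ℝ) :
    canonicalForm M (x + y) z = canonicalForm M x z + canonicalForm M y z := by
  simp only [canonicalForm, Pi.add_apply, add_mul, Finset.sum_add_distrib]

lemma canonicalForm_smul_left (M : CoxeterMatrix B) (c : ℝ) (x z : B → ℝ) :
    canonicalForm M (c • x) z = c * canonicalForm M x z := by
  simp only [canonicalForm, Pi.smul_apply, smul_eq_mul, Finset.mul_sum, mul_assoc]

lemma canonicalForm_neg_left (M : CoxeterMatrix B) (x z : B → ℝ) :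
    canonicalForm M (-x) z = -canonicalForm M x z := by
  rw [← neg_one_smul ℝ x, canonicalForm_smul_left, neg_one_mul]

lemma canonicalForm_sub_left (M : CoxeterMatrix B) (x y z : B → ℝ) :
    canonicalForm M (x - y) z = canonicalForm M x z - canonicalForm M y z := by
  rw [sub_eq_add_neg, canonicalForm_add_left, canonicalForm_neg_left, sub_eq_add_neg]

lemma canonicalForm_add_right (M : CoxeterMatrix B) (x y z : B → ℝ) :
    canonicalForm M z (x + y) = canonicalForm M z x + canonicalForm M z y := by
  simp only [canonicalForm_comm M z, canonicalForm_add_left]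

lemma canonicalForm_smul_right (M : CoxeterMatrix B) (c : ℝ) (x z : B → ℝ) :
    canonicalForm M z (c • x) = c * canonicalForm M z x := by
  simp only [canonicalForm_comm M z, canonicalForm_smul_left]

lemma canonicalForm_neg_right (M : CoxeterMatrix B) (x z : B → ℝ) :
    canonicalForm M z (-x) = -canonicalForm M z x := by
  simp only [canonicalForm_comm M z, canonicalForm_neg_left]

lemma canonicalForm_sub_right (M : CoxeterMatrix B) (x y z : B → ℝ) :
    canonicalForm M z (x - y) = canonicalForm M z x - canonicalForm M z y := by
  simp only [canonicalForm_comm M z, canonicalForm_sub_left]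

lemma canonicalForm_simpleRoot_right (M : CoxeterMatrix B) (x : B → ℝ) (t : B) :
    canonicalForm M x (simpleRoot t) = ∑ s, x s * formEntry M s t := by
  simp [canonicalForm, simpleRoot, Pi.single_apply]

lemma canonicalForm_simpleRoot (M : CoxeterMatrix B) (s t : B) :
    canonicalForm M (simpleRoot s) (simpleRoot t) = formEntry M s t := by
  rw [canonicalForm_simpleRoot_right]
  simp [simpleRoot, Pi.single_apply]

lemma canonicalForm_simpleRoot_self (M : CoxeterMatrix B) (s : B) :
    canonicalForm M (simpleRoot s) (simpleRoot s) = 1 := by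
  rw [canonicalForm_simpleRoot, formEntry_self]

/-! ### Positive vectors -/

lemma IsPos.add {x y : B → ℝ} (hx : IsPos x) (hy : IsPos y) : IsPos (x + y) :=
  fun t => add_nonneg (hx t) (hy t)

lemma IsPos.smul {x : B → ℝ} (hx : IsPos x) {c : ℝ} (hc : 0 ≤ c) : IsPos (c • x) :=
  fun t => mul_nonneg hc (hx t)

lemma IsPos.eq_zero {x : B → ℝ} (hx : IsPos x) (hx' : IsPos (-x)) : x = 0 :=
  funext fun t => le_antisymm (neg_nonneg.1 (hx' t)) (hx t)

lemma isPos_simpleRoot (s : B) : IsPos (simpleRoot s) := by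
  intro t
  by_cases h : t = s <;> simp [simpleRoot, h]

/-! ### The canonical representation -/

/-- `ρ` is the canonical representation of the Coxeter system. -/
def IsCanonical (cs : CoxeterSystem M W) (ρ : W →* ((B → ℝ) ≃ₗ[ℝ] (B → ℝ))) : Prop :=
  ∀ (s : B) (x : B → ℝ), ρ (cs.simple s) x =
    x - (2 * canonicalForm M x (simpleRoot s)) • simpleRoot s

lemma rho_mul (ρ : W →* ((B → ℝ) ≃ₗ[ℝ] (B → ℝ))) (u v : W) (x : B → ℝ) :
    ρ (u * v) x = ρ u (ρ v x) := by
  rw [map_mul]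
  rfl

lemma rho_one (ρ : W →* ((B → ℝ) ≃ₗ[ℝ] (B → ℝ))) (x : B → ℝ) : ρ 1 x = x := by
  rw [map_one]
  rfl

lemma rho_inv_rho (ρ : W →* ((B → ℝ) ≃ₗ[ℝ] (B → ℝ))) (u : W) (x : B → ℝ) :
    ρ u⁻¹ (ρ u x) = x := by
  rw [← rho_mul, inv_mul_cancel, rho_one]

lemma rho_rho_inv (ρ : W →* ((B → ℝ) ≃ₗ[ℝ] (B → ℝ))) (u : W) (x : B → ℝ) :
    ρ u (ρ u⁻¹ x) = x := by
  rw [← rho_mul, mul_inv_cancel, rho_one]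

variable {cs : CoxeterSystem M W} {ρ : W →* ((B → ℝ) ≃ₗ[ℝ] (B → ℝ))}

lemma IsCanonical.form_rho (hρ : IsCanonical cs ρ) (u : W) (x y : B → ℝ) :
    canonicalForm M (ρ u x) (ρ u y) = canonicalForm M x y := by
  induction u using cs.simple_induction_left generalizing x y with
  | one => simp only [rho_one]
  | mul_simple_left v s ih =>
    rw [rho_mul, rho_mul, hρ, hρ, canonicalForm_sub_left, canonicalForm_sub_right,
      canonicalForm_sub_right, canonicalForm_smul_left, canonicalForm_smul_left,
      canonicalForm_smul_right, canonicalForm_smul_right, canonicalForm_simpleRoot_self, ih,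
      canonicalForm_comm M (simpleRoot s)]
    ring

lemma IsCanonical.rho_simple_self (hρ : IsCanonical cs ρ) (s : B) :
    ρ (cs.simple s) (simpleRoot s) = -simpleRoot s := by
  rw [hρ, canonicalForm_simpleRoot_self]
  module

/-- The coefficients of the roots of a rank two root system whose simple roots have product
`-c`. -/
def dihedralCoeff (c : ℝ) : ℕ → ℝ
  | 0 => 0
  | 1 => 1
  | n + 2 => 2 * c * dihedralCoeff c (n + 1) - dihedralCoeff c n

lemma dihedralCoeff_one (n : ℕ) : dihedralCoeff 1 n = n := by
  induction n using Nat.twoStepInduction with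
  | zero => simp [dihedralCoeff]
  | one => simp [dihedralCoeff]
  | more n ih1 ih2 =>
    rw [dihedralCoeff, ih1, ih2]
    push_cast
    ring

lemma dihedralCoeff_cos (θ : ℝ) (n : ℕ) :
    dihedralCoeff (Real.cos θ) n * Real.sin θ = Real.sin (n * θ) := by
  induction n using Nat.twoStepInduction with
  | zero => simp [dihedralCoeff]
  | one => simp [dihedralCoeff]
  | more n ih1 ih2 =>
    rw [dihedralCoeff, sub_mul, ih1, mul_assoc, ih2]
    have e1 : ((n + 2 : ℕ) : ℝ) * θ = ((n + 1 : ℕ) : ℝ) * θ + θ := by push_cast; ring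
    have e2 : (n : ℝ) * θ = ((n + 1 : ℕ) : ℝ) * θ - θ := by push_cast; ring
    rw [e1, e2, Real.sin_add, Real.sin_sub]
    ring

lemma dihedralCoeff_nonneg (M : CoxeterMatrix B) {s t : B} (hst : s ≠ t) {n : ℕ}
    (hn : M s t = 0 ∨ n ≤ M s t) : 0 ≤ dihedralCoeff (-formEntry M s t) n := by
  unfold formEntry
  split_ifs with h0
  · rw [neg_neg, dihedralCoeff_one]
    positivity
  · have h1 := M.off_diagonal s t hst
    have hm : (2 : ℝ) ≤ M s t := by exact_mod_cast (show 2 ≤ M s t by omega)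
    have hn' : (n : ℝ) ≤ M s t := by exact_mod_cast hn.resolve_left h0
    have hm0 : (0 : ℝ) < M s t := by linarith
    have hpos : 0 < Real.sin (Real.pi / M s t) := by
      apply Real.sin_pos_of_pos_of_lt_pi
      · positivity
      · rw [div_lt_iff₀ hm0]
        nlinarith [Real.pi_pos]
    rw [neg_neg]
    refine nonneg_of_mul_nonneg_left ?_ hpos
    rw [dihedralCoeff_cos]
    apply Real.sin_nonneg_of_nonneg_of_le_pi
    · positivity
    · rw [mul_div_assoc', div_le_iff₀ hm0, mul_comm]
      exact mul_le_mul_of_nonneg_left hn' Real.pi_pos.le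

lemma IsCanonical.rho_alternatingWord (hρ : IsCanonical cs ρ) (s t : B) (k : ℕ) :
    ρ (cs.wordProd (CoxeterSystem.alternatingWord s t k)) (simpleRoot s) =
      if Even k then
        dihedralCoeff (-formEntry M s t) (k + 1) • simpleRoot s +
          dihedralCoeff (-formEntry M s t) k • simpleRoot t
      else
        dihedralCoeff (-formEntry M s t) k • simpleRoot s +
          dihedralCoeff (-formEntry M s t) (k + 1) • simpleRoot t := by
  induction k with
  | zero => simp [CoxeterSystem.alternatingWord, dihedralCoeff]
  | succ k ih =>
    rw [CoxeterSystem.alternatingWord_succ', cs.wordProd_cons, rho_mul, ih]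
    by_cases hk : Even k
    · have hk' : ¬ Even (k + 1) := by simpa [Nat.even_add_one] using hk
      rw [if_pos hk, if_pos hk, if_neg hk', hρ, canonicalForm_add_left, canonicalForm_smul_left,
        canonicalForm_smul_left, canonicalForm_simpleRoot, canonicalForm_simpleRoot_self,
        dihedralCoeff]
      module
    · have hk' : Even (k + 1) := by simpa [Nat.even_add_one] using hk
      rw [if_neg hk, if_neg hk, if_pos hk', hρ, canonicalForm_add_left, canonicalForm_smul_left,
        canonicalForm_smul_left, canonicalForm_simpleRoot_self, canonicalForm_simpleRoot,
        formEntry_comm M t s, dihedralCoeff]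
      module

/-- An element that lengthens on right multiplication by `s` maps `α_s` to a positive root. -/
lemma IsCanonical.isPos_of_length_lt (hρ : IsCanonical cs ρ) {w : W} {s : B}
    (h : cs.length w < cs.length (w * cs.simple s)) : IsPos (ρ w (simpleRoot s)) := by
  induction hn : cs.length w using Nat.strong_induction_on generalizing w s with
  | _ n ih =>
  subst hn
  by_cases hw : w = 1
  · rw [hw, rho_one]
    exact isPos_simpleRoot s
  obtain ⟨t, ht⟩ := cs.exists_rightDescent_of_ne_one hw
  have hst : s ≠ t := by
    rintro rfl
    exact absurd ht (not_lt.2 h.le)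
  let P : ℕ → Prop := fun k => ∃ v : W,
    w = v * cs.wordProd (CoxeterSystem.alternatingWord s t k) ∧ cs.length v + k = cs.length w
  have hP1 : P 1 := by
    refine ⟨w * cs.simple t, ?_, (cs.isRightDescent_iff).1 ht⟩
    simp [CoxeterSystem.alternatingWord]
  have hbound : ∀ k, P k → k ≤ cs.length w := by
    rintro k ⟨v, -, hv⟩
    omega
  classical
  obtain ⟨k, hk1, ⟨v, hwv, hlen⟩, hmax⟩ :
      ∃ k, 1 ≤ k ∧ P k ∧ ¬ P (k + 1) := by
    have hk := Nat.findGreatest_spec (P := P) (hbound 1 hP1) hP1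
    refine ⟨Nat.findGreatest P (cs.length w), Nat.le_findGreatest (hbound 1 hP1) hP1, hk,
      fun h' => ?_⟩
    have := Nat.le_findGreatest (hbound _ h') h'
    omega
  have hred : cs.IsReduced (CoxeterSystem.alternatingWord s t k) := by
    have h1 := cs.length_mul_le v (cs.wordProd (CoxeterSystem.alternatingWord s t k))
    have h2 := cs.length_wordProd_le (CoxeterSystem.alternatingWord s t k)
    rw [← hwv] at h1
    rw [CoxeterSystem.length_alternatingWord] at h2
    rw [CoxeterSystem.IsReduced, CoxeterSystem.length_alternatingWord]
    omega
  have hkm : M s t = 0 ∨ k + 1 ≤ M s t := by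
    by_contra! hcon
    obtain ⟨hm0, hm1⟩ := hcon
    have hkle : k ≤ M s t := by
      by_contra! hlt
      exact cs.not_isReduced_alternatingWord s t hm0 hlt hred
    have hkm : k = M s t := by omega
    have hbraid : cs.wordProd (CoxeterSystem.alternatingWord s t k) =
        cs.wordProd (CoxeterSystem.alternatingWord t s k) := by
      have := cs.wordProd_braidWord_eq s t
      rw [CoxeterSystem.braidWord, CoxeterSystem.braidWord, M.symmetric t s, ← hkm] at this
      exact this
    obtain ⟨j, rfl⟩ : ∃ j, k = j + 1 := ⟨k - 1, by omega⟩
    have hws : w * cs.simple s = v * cs.wordProd (CoxeterSystem.alternatingWord s t j) := by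
      rw [hwv, hbraid, CoxeterSystem.alternatingWord_succ, cs.wordProd_concat]
      simp [mul_assoc]
    have h1 := cs.length_mul_le v (cs.wordProd (CoxeterSystem.alternatingWord s t j))
    have h2 := cs.length_wordProd_le (CoxeterSystem.alternatingWord s t j)
    rw [← hws] at h1
    rw [CoxeterSystem.length_alternatingWord] at h2
    omega
  have key : ∀ r, r = s ∨ r = t → cs.length v < cs.length (v * cs.simple r) := by
    intro r hr
    by_contra! hcon
    have hdesc : cs.length (v * cs.simple r) + 1 = cs.length v := by
      rcases cs.length_mul_simple v r with h' | h' <;> omega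
    by_cases hr' : r = if Even k then t else s
    · refine hmax ⟨v * cs.simple r, ?_, by omega⟩
      rw [CoxeterSystem.alternatingWord_succ', ← hr', cs.wordProd_cons, hwv]
      simp [mul_assoc]
    · obtain ⟨j, rfl⟩ : ∃ j, k = j + 1 := ⟨k - 1, by omega⟩
      have hr2 : r = if Even j then t else s := by
        by_cases hj : Even j
        · have hj' : ¬ Even (j + 1) := by simpa [Nat.even_add_one] using hj
          rw [if_neg hj'] at hr'
          rw [if_pos hj]
          tauto
        · have hj' : Even (j + 1) := by simpa [Nat.even_add_one] using hj
          rw [if_pos hj'] at hr'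
          rw [if_neg hj]
          tauto
      have hw' : w = v * cs.simple r * cs.wordProd (CoxeterSystem.alternatingWord s t j) := by
        rw [hwv, CoxeterSystem.alternatingWord_succ', ← hr2, cs.wordProd_cons, mul_assoc]
      have h1 := cs.length_mul_le (v * cs.simple r)
        (cs.wordProd (CoxeterSystem.alternatingWord s t j))
      have h2 := cs.length_wordProd_le (CoxeterSystem.alternatingWord s t j)
      rw [← hw'] at h1
      rw [CoxeterSystem.length_alternatingWord] at h2
      omega
  have hs := ih _ (by omega) (key s (Or.inl rfl)) rfl
  have ht' := ih _ (by omega) (key t (Or.inr rfl)) rfl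
  have hc1 : 0 ≤ dihedralCoeff (-formEntry M s t) k :=
    dihedralCoeff_nonneg M hst (hkm.imp_right (by omega))
  have hc2 : 0 ≤ dihedralCoeff (-formEntry M s t) (k + 1) := dihedralCoeff_nonneg M hst hkm
  rw [hwv, rho_mul, hρ.rho_alternatingWord]
  split_ifs
  · rw [map_add, map_smul, map_smul]
    exact (hs.smul hc2).add (ht'.smul hc1)
  · rw [map_add, map_smul, map_smul]
    exact (hs.smul hc1).add (ht'.smul hc2)

/-! ### Roots -/

lemma IsRoot.map {α : B → ℝ} (h : IsRoot ρ α) (u : W) : IsRoot ρ (ρ u α) := by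
  obtain ⟨v, s, rfl⟩ := h
  exact ⟨u * v, s, (rho_mul ρ u v _).symm⟩

lemma isRoot_simpleRoot (ρ : W →* ((B → ℝ) ≃ₗ[ℝ] (B → ℝ))) (s : B) :
    IsRoot ρ (simpleRoot s) :=
  ⟨1, s, (rho_one ρ _).symm⟩

lemma IsCanonical.rho_mul_simple (hρ : IsCanonical cs ρ) (w : W) (s : B) :
    ρ (w * cs.simple s) (simpleRoot s) = -ρ w (simpleRoot s) := by
  rw [rho_mul, hρ.rho_simple_self, map_neg]

lemma IsCanonical.isRoot_neg (hρ : IsCanonical cs ρ) {α : B → ℝ} (h : IsRoot ρ α) :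
    IsRoot ρ (-α) := by
  obtain ⟨v, s, rfl⟩ := h
  exact ⟨v * cs.simple s, s, (hρ.rho_mul_simple v s).symm⟩

lemma IsCanonical.isPos_neg_of_length_lt (hρ : IsCanonical cs ρ) {w : W} {s : B}
    (h : cs.length (w * cs.simple s) < cs.length w) : IsPos (-ρ w (simpleRoot s)) := by
  rw [← hρ.rho_mul_simple]
  apply hρ.isPos_of_length_lt
  simpa [mul_assoc] using h

/-- Every root is positive or negative. -/
lemma IsCanonical.isPos_or_isPos_neg (hρ : IsCanonical cs ρ) {α : B → ℝ} (h : IsRoot ρ α) :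
    IsPos α ∨ IsPos (-α) := by
  obtain ⟨w, s, rfl⟩ := h
  rcases lt_or_gt_of_ne (cs.length_mul_simple_ne w s) with h | h
  · exact Or.inr (hρ.isPos_neg_of_length_lt h)
  · exact Or.inl (hρ.isPos_of_length_lt h)

lemma IsCanonical.form_self (hρ : IsCanonical cs ρ) {α : B → ℝ} (h : IsRoot ρ α) :
    canonicalForm M α α = 1 := by
  obtain ⟨w, s, rfl⟩ := h
  rw [hρ.form_rho, canonicalForm_simpleRoot_self]

lemma IsCanonical.root_ne_zero (hρ : IsCanonical cs ρ) {α : B → ℝ} (h : IsRoot ρ α) :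
    α ≠ 0 := by
  rintro rfl
  have := hρ.form_self h
  simp [canonicalForm] at this

lemma IsCanonical.not_isPos_neg (hρ : IsCanonical cs ρ) {α : B → ℝ} (h : IsRoot ρ α)
    (h1 : IsPos α) : ¬ IsPos (-α) :=
  fun h2 => hρ.root_ne_zero h (h1.eq_zero h2)

lemma IsCanonical.isPos_neg_iff (hρ : IsCanonical cs ρ) {α : B → ℝ} (h : IsRoot ρ α) :
    IsPos (-α) ↔ ¬ IsPos α :=
  ⟨fun h1 h2 => hρ.not_isPos_neg h h2 h1, (hρ.isPos_or_isPos_neg h).resolve_left⟩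

/-- The simple reflection `s` permutes the positive roots other than `α_s`. -/
lemma IsCanonical.eq_simpleRoot (hρ : IsCanonical cs ρ) {α : B → ℝ} (h : IsRoot ρ α)
    (h1 : IsPos α) {s : B} (h2 : IsPos (-ρ (cs.simple s) α)) : α = simpleRoot s := by
  have hα : α = α s • simpleRoot s := by
    funext t
    by_cases ht : t = s
    · subst ht
      simp [simpleRoot]
    · have h3 := h2 t
      rw [hρ] at h3
      simp only [simpleRoot, Pi.neg_apply, Pi.sub_apply, Pi.smul_apply, smul_eq_mul,
        Pi.single_apply, ht, if_false, mul_zero, sub_zero] at h3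
      have : α t = 0 := le_antisymm (by linarith) (h1 t)
      simp [simpleRoot, ht, this]
  have hn := hρ.form_self h
  rw [hα, canonicalForm_smul_left, canonicalForm_smul_right, canonicalForm_simpleRoot_self] at hn
  have : α s = 1 := by nlinarith [h1 s]
  rw [hα, this, one_smul]

/-- An element of the Coxeter group has finitely many inversions. -/
lemma IsCanonical.finite_inversions (hρ : IsCanonical cs ρ) (v : W) :
    {α : B → ℝ | IsRoot ρ α ∧ IsPos α ∧ IsPos (-ρ v α)}.Finite := by
  induction v using cs.simple_induction_right with
  | one =>
    convert Set.finite_empty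
    ext α
    simp only [rho_one, Set.mem_ofPred_eq, Set.mem_empty_iff_false, iff_false]
    rintro ⟨h, h1, h2⟩
    exact hρ.not_isPos_neg h h1 h2
  | mul_simple_right v s ih =>
    refine ((ih.image (ρ (cs.simple s))).union (Set.finite_singleton (simpleRoot s))).subset ?_
    rintro α ⟨h, h1, h2⟩
    rcases hρ.isPos_or_isPos_neg (h.map (cs.simple s)) with h3 | h3
    · left
      refine ⟨ρ (cs.simple s) α, ⟨h.map _, h3, by rwa [← rho_mul]⟩, ?_⟩
      rw [← rho_mul, cs.simple_mul_simple_self, rho_one]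
    · exact Or.inr (hρ.eq_simpleRoot h h1 h3)

/-- Only finitely many roots have different signs at two given elements. -/
lemma IsCanonical.finite_separating (hρ : IsCanonical cs ρ) (u v : W) :
    {α : B → ℝ | IsRoot ρ α ∧ IsPos (ρ u α) ∧ IsPos (-ρ v α)}.Finite := by
  refine ((hρ.finite_inversions (v * u⁻¹)).image (ρ u⁻¹)).subset ?_
  rintro α ⟨h, h1, h2⟩
  refine ⟨ρ u α, ⟨h.map u, h1, ?_⟩, rho_inv_rho ρ u α⟩
  rwa [← rho_mul, inv_mul_cancel_right]

/-- The canonical representation is faithful. -/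
lemma IsCanonical.eq_one (hρ : IsCanonical cs ρ) {w : W}
    (h : ∀ s, ρ w (simpleRoot s) = simpleRoot s) : w = 1 := by
  by_contra hw
  obtain ⟨s, hs⟩ := cs.exists_rightDescent_of_ne_one hw
  have := hρ.isPos_neg_of_length_lt hs
  rw [h s] at this
  exact hρ.not_isPos_neg (isRoot_simpleRoot ρ s) (isPos_simpleRoot s) this

lemma IsCanonical.injective (hρ : IsCanonical cs ρ) : Function.Injective ρ := by
  intro u v huv
  rw [← mul_inv_eq_one]
  apply hρ.eq_one
  intro s
  rw [rho_mul, huv, rho_rho_inv]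

/-- Induction on the depth of a positive root. -/
lemma IsCanonical.root_induction (hρ : IsCanonical cs ρ) {p : (B → ℝ) → Prop}
    (simple : ∀ s, p (simpleRoot s))
    (step : ∀ (γ : B → ℝ) (s : B), IsRoot ρ γ → IsPos γ → 0 < canonicalForm M γ (simpleRoot s) →
      IsPos (ρ (cs.simple s) γ) → p (ρ (cs.simple s) γ) → p γ)
    {γ : B → ℝ} (h : IsRoot ρ γ) (h1 : IsPos γ) : p γ := by
  obtain ⟨v, hv⟩ : ∃ v : W, IsPos (-ρ v γ) := by
    obtain ⟨w, s, rfl⟩ := h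
    refine ⟨cs.simple s * w⁻¹, ?_⟩
    rw [rho_mul, rho_inv_rho, hρ.rho_simple_self, neg_neg]
    exact isPos_simpleRoot s
  induction hn : cs.length v using Nat.strong_induction_on generalizing v γ with
  | _ n ih =>
  subst hn
  have hv1 : v ≠ 1 := by
    rintro rfl
    rw [rho_one] at hv
    exact hρ.not_isPos_neg h h1 hv
  obtain ⟨s, hs⟩ := cs.exists_rightDescent_of_ne_one hv1
  rcases hρ.isPos_or_isPos_neg (h.map (cs.simple s)) with h2 | h2
  · have e1 : ρ (v * cs.simple s) (ρ (cs.simple s) γ) = ρ v γ := by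
      rw [← rho_mul, mul_assoc, cs.simple_mul_simple_self, mul_one]
    rcases lt_or_ge 0 (canonicalForm M γ (simpleRoot s)) with h3 | h3
    · exact step γ s h h1 h3 h2 (ih _ hs (h.map _) h2 (v * cs.simple s) (by rwa [e1]) rfl)
    · refine ih _ hs h h1 (v * cs.simple s) ?_ rfl
      have h4 := hρ.isPos_neg_of_length_lt hs
      rw [← hρ.rho_mul_simple] at h4
      have e2 : -ρ (v * cs.simple s) γ = -ρ v γ +
          (-(2 * canonicalForm M γ (simpleRoot s))) • ρ (v * cs.simple s) (simpleRoot s) := by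
        rw [← e1, hρ s γ, map_sub, map_smul]
        module
      rw [e2]
      exact hv.add (h4.smul (by linarith))
  · rw [hρ.eq_simpleRoot h h1 h2]
    exact simple s

/-! ### Reflections -/

open Classical in
/-- The reflection `u s u⁻¹` in the root `u α_s`. -/
def rootReflection (cs : CoxeterSystem M W) (ρ : W →* ((B → ℝ) ≃ₗ[ℝ] (B → ℝ)))
    (α : B → ℝ) : W :=
  if h : IsRoot ρ α then
    h.choose * cs.simple h.choose_spec.choose * h.choose⁻¹
  else 1

lemma IsCanonical.rho_conj_simple (hρ : IsCanonical cs ρ) (u : W) (s : B) (x : B → ℝ) :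
    ρ (u * cs.simple s * u⁻¹) x =
      x - (2 * canonicalForm M x (ρ u (simpleRoot s))) • ρ u (simpleRoot s) := by
  have e : canonicalForm M (ρ u⁻¹ x) (simpleRoot s) = canonicalForm M x (ρ u (simpleRoot s)) := by
    rw [← hρ.form_rho u, rho_rho_inv]
  rw [rho_mul, rho_mul, hρ, map_sub, map_smul, rho_rho_inv, e]

lemma IsCanonical.rho_rootReflection (hρ : IsCanonical cs ρ) {α : B → ℝ} (h : IsRoot ρ α)
    (x : B → ℝ) : ρ (rootReflection cs ρ α) x = x - (2 * canonicalForm M x α) • α := by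
  rw [rootReflection, dif_pos h, hρ.rho_conj_simple, ← h.choose_spec.choose_spec]

lemma IsCanonical.eq_rootReflection (hρ : IsCanonical cs ρ) {α : B → ℝ} (h : IsRoot ρ α) {t : W}
    (ht : ∀ x, ρ t x = x - (2 * canonicalForm M x α) • α) : t = rootReflection cs ρ α := by
  apply hρ.injective
  ext1 x
  rw [ht, hρ.rho_rootReflection h]

lemma IsCanonical.rootReflection_map_simple (hρ : IsCanonical cs ρ) (u : W) (s : B) :
    rootReflection cs ρ (ρ u (simpleRoot s)) = u * cs.simple s * u⁻¹ :=
  (hρ.eq_rootReflection ⟨u, s, rfl⟩ (hρ.rho_conj_simple u s)).symm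

lemma IsCanonical.rootReflection_simple (hρ : IsCanonical cs ρ) (s : B) :
    rootReflection cs ρ (simpleRoot s) = cs.simple s := by
  have := hρ.rootReflection_map_simple 1 s
  rwa [rho_one, one_mul, inv_one, mul_one] at this

lemma IsCanonical.rootReflection_map (hρ : IsCanonical cs ρ) {α : B → ℝ} (h : IsRoot ρ α)
    (g : W) : rootReflection cs ρ (ρ g α) = g * rootReflection cs ρ α * g⁻¹ := by
  obtain ⟨u, s, rfl⟩ := h
  rw [← rho_mul, hρ.rootReflection_map_simple, hρ.rootReflection_map_simple]
  group

lemma IsCanonical.rootReflection_neg (hρ : IsCanonical cs ρ) {α : B → ℝ} (h : IsRoot ρ α) :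
    rootReflection cs ρ (-α) = rootReflection cs ρ α := by
  apply hρ.eq_rootReflection h
  intro x
  rw [hρ.rho_rootReflection (hρ.isRoot_neg h), canonicalForm_neg_right]
  module

lemma IsCanonical.rho_rootReflection_self (hρ : IsCanonical cs ρ) {α : B → ℝ}
    (h : IsRoot ρ α) : ρ (rootReflection cs ρ α) α = -α := by
  rw [hρ.rho_rootReflection h, hρ.form_self h]
  module

lemma IsCanonical.rootReflection_mul_self (hρ : IsCanonical cs ρ) {α : B → ℝ}
    (h : IsRoot ρ α) : rootReflection cs ρ α * rootReflection cs ρ α = 1 := by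
  obtain ⟨u, s, rfl⟩ := h
  rw [hρ.rootReflection_map_simple]
  simp [mul_assoc]

/-! ### Standard parabolic subgroups -/

/-- A standard parabolic subgroup does not change the coordinates outside its type. -/
lemma IsCanonical.rho_apply_of_mem_standardParabolic (hρ : IsCanonical cs ρ) {X : Set B} {g : W}
    (hg : g ∈ standardParabolic cs X) (x : B → ℝ) {t : B} (ht : t ∉ X) : ρ g x t = x t := by
  induction hg using Subgroup.closure_induction generalizing x with
  | mem g hg =>
    obtain ⟨s, hs, rfl⟩ := hg
    have : t ≠ s := fun h => ht (h ▸ hs)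
    simp [hρ s x, simpleRoot, this]
  | one => rw [rho_one]
  | mul g h _ _ ihg ihh => rw [rho_mul, ihg, ihh]
  | inv g _ ih => rw [← ih (ρ g⁻¹ x), rho_rho_inv]

lemma IsCanonical.eq_univ_of_standardParabolic_eq_top (hρ : IsCanonical cs ρ) {X : Set B}
    (hX : standardParabolic cs X = ⊤) : X = Set.univ := by
  by_contra hne
  obtain ⟨t, ht⟩ := (Set.ne_univ_iff_exists_notMem X).1 hne
  have h := hρ.rho_apply_of_mem_standardParabolic (g := cs.simple t) (hX ▸ Subgroup.mem_top _)
    (simpleRoot t) ht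
  rw [hρ.rho_simple_self] at h
  simp only [simpleRoot, Pi.neg_apply, Pi.single_eq_same] at h
  norm_num at h

lemma simple_mem_standardParabolic {X : Set B} {s : B} (hs : s ∈ X) :
    cs.simple s ∈ standardParabolic cs X :=
  Subgroup.subset_closure ⟨s, hs, rfl⟩

/-- The reflection in a root supported on `X` lies in `W_X`. -/
lemma IsCanonical.rootReflection_mem_standardParabolic (hρ : IsCanonical cs ρ) {X : Set B}
    {α : B → ℝ} (h : IsRoot ρ α) (hα : ∀ t ∉ X, α t = 0) :
    rootReflection cs ρ α ∈ standardParabolic cs X := by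
  wlog hpos : IsPos α generalizing α
  · rw [← hρ.rootReflection_neg h]
    exact this (hρ.isRoot_neg h) (fun t ht => by rw [Pi.neg_apply, hα t ht, neg_zero])
      ((hρ.isPos_neg_iff h).2 hpos)
  revert hα
  refine hρ.root_induction (p := fun α => (∀ t ∉ X, α t = 0) →
    rootReflection cs ρ α ∈ standardParabolic cs X) ?_ ?_ h hpos
  · intro s hs
    rw [hρ.rootReflection_simple]
    apply simple_mem_standardParabolic
    by_contra hsX
    simpa [simpleRoot] using hs s hsX
  · intro γ s hγ hγpos hform _ ih hsupp
    have hs : s ∈ X := by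
      by_contra hsX
      refine absurd hform (not_lt.2 ?_)
      rw [canonicalForm_simpleRoot_right]
      refine Finset.sum_nonpos fun t _ => ?_
      by_cases hts : t = s
      · rw [hts, hsupp s hsX, zero_mul]
      · exact mul_nonpos_of_nonneg_of_nonpos (hγpos t) (formEntry_nonpos M hts)
    have hmem := simple_mem_standardParabolic (cs := cs) hs
    have := ih fun t ht => by
      rw [hρ.rho_apply_of_mem_standardParabolic hmem _ ht, hsupp t ht]
    rw [hρ.rootReflection_map hγ] at this
    exact ((standardParabolic cs X).mul_mem_cancel_left hmem).1
      (((standardParabolic cs X).mul_mem_cancel_right (inv_mem hmem)).1 this)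

/-! ### Sign changes of sequences indexed by the integers -/

lemma even_ncard_signChanges (p : ℤ → Prop) (a : ℤ) (n : ℕ) :
    Even ({m : ℤ | ¬ (p m ↔ p (m + 1))} ∩ Set.Ico a (a + n)).ncard ↔ (p a ↔ p (a + n)) := by
  induction n with
  | zero => simp
  | succ n ih =>
    set D : Set ℤ := {m : ℤ | ¬ (p m ↔ p (m + 1))} with hD
    have hfin : (D ∩ Set.Ico a (a + n)).Finite := (Set.finite_Ico _ _).inter_of_right _
    have hmem : ∀ m, m ∈ D ↔ ¬ (p m ↔ p (m + 1)) := fun m => Iff.rfl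
    have hcast : a + ((n + 1 : ℕ) : ℤ) = a + n + 1 := by push_cast; ring
    rw [hcast]
    by_cases h : a + (n : ℤ) ∈ D
    · have e : D ∩ Set.Ico a (a + n + 1) = insert (a + (n : ℤ)) (D ∩ Set.Ico a (a + n)) := by
        ext m
        simp only [Set.mem_inter_iff, Set.mem_Ico, Set.mem_insert_iff]
        constructor
        · rintro ⟨h1, h2, h3⟩
          by_cases hm : m = a + n
          · exact Or.inl hm
          · exact Or.inr ⟨h1, h2, by omega⟩
        · rintro (rfl | ⟨h1, h2, h3⟩)
          · exact ⟨h, by omega, by omega⟩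
          · exact ⟨h1, h2, by omega⟩
      rw [e, Set.ncard_insert_of_notMem (by simp) hfin, Nat.even_add_one, ih]
      rw [hmem] at h
      tauto
    · have e : D ∩ Set.Ico a (a + n + 1) = D ∩ Set.Ico a (a + n) := by
        ext m
        simp only [Set.mem_inter_iff, Set.mem_Ico]
        constructor
        · rintro ⟨h1, h2, h3⟩
          have hm : m ≠ a + n := fun hm => h (hm ▸ h1)
          exact ⟨h1, h2, by omega⟩
        · rintro ⟨h1, h2, h3⟩
          exact ⟨h1, h2, by omega⟩
      rw [e, ih]
      rw [hmem, not_not] at h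
      tauto

/-- A sequence with finitely many sign changes is eventually constant at both ends, and the two
eventual values differ if and only if the number of sign changes is odd. -/
lemma exists_stabilization {p : ℤ → Prop} (hD : {m : ℤ | ¬ (p m ↔ p (m + 1))}.Finite) :
    ∃ N : ℤ, (∀ m, N ≤ m → (p m ↔ p N)) ∧ (∀ m, m ≤ -N → (p m ↔ p (-N))) ∧
      (Odd {m : ℤ | ¬ (p m ↔ p (m + 1))}.ncard ↔ ¬ (p (-N) ↔ p N)) := by
  set D : Set ℤ := {m : ℤ | ¬ (p m ↔ p (m + 1))} with hDdef
  have hmem : ∀ m, m ∉ D → (p m ↔ p (m + 1)) := fun m => not_not.1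
  obtain ⟨a, ha⟩ := hD.bddBelow
  obtain ⟨b, hb⟩ := hD.bddAbove
  obtain ⟨n, hn⟩ : ∃ n : ℕ, (n : ℤ) = |a| + |b| + 1 :=
    ⟨(|a| + |b| + 1).toNat, Int.toNat_of_nonneg (by positivity)⟩
  have hlow : ∀ m ∈ D, -(n : ℤ) ≤ m := fun m hm => by
    have := ha hm
    have := neg_abs_le a
    have := abs_nonneg b
    omega
  have hupp : ∀ m ∈ D, m < n := fun m hm => by
    have := hb hm
    have := le_abs_self b
    have := abs_nonneg a
    omega
  refine ⟨n, ?_, ?_, ?_⟩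
  · intro m hm
    induction m, hm using Int.leInduction with
    | base => exact Iff.rfl
    | succ m hm ih =>
      rw [← ih]
      exact (hmem m fun h => absurd (hupp m h) (not_lt.2 hm)).symm
  · intro m hm
    induction m, hm using Int.leInductionDown with
    | base => exact Iff.rfl
    | pred m hm ih =>
      rw [← ih]
      have := hmem (m - 1) fun h => by
        have := hlow _ h
        omega
      rwa [sub_add_cancel] at this
  · have h := even_ncard_signChanges p (-n) (2 * n)
    have e1 : -(n : ℤ) + ((2 * n : ℕ) : ℤ) = n := by push_cast; ring
    have e2 : D ∩ Set.Ico (-(n : ℤ)) n = D :=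
      Set.inter_eq_left.2 fun m hm => ⟨hlow m hm, hupp m hm⟩
    rw [e1, ← hDdef, e2] at h
    rw [← Nat.not_even_iff_odd, h]

/-! ### Periodic roots and the signs of a root along `w ^ m` -/

/-- `ρ (w ^ m) α` is positive for all `m` sufficiently far along `l`. -/
def EventuallyPos (ρ : W →* ((B → ℝ) ≃ₗ[ℝ] (B → ℝ))) (w : W) (l : Filter ℤ) (α : B → ℝ) :
    Prop :=
  ∀ᶠ m in l, IsPos (ρ (w ^ m) α)

/-- `l` is one of the two ends of `ℤ`. -/
def IsEnd (l : Filter ℤ) : Prop := l = Filter.atTop ∨ l = Filter.atBot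

lemma IsEnd.le_cofinite {l : Filter ℤ} (hl : IsEnd l) : l ≤ Filter.cofinite := by
  rw [Int.cofinite_eq]
  rcases hl with rfl | rfl
  · exact le_sup_right
  · exact le_sup_left

lemma IsEnd.neBot {l : Filter ℤ} (hl : IsEnd l) : l.NeBot := by
  rcases hl with rfl | rfl <;> infer_instance

lemma IsEnd.frequently_dvd {l : Filter ℤ} (hl : IsEnd l) {k : ℕ} (hk : 1 ≤ k) :
    ∃ᶠ m in l, (k : ℤ) ∣ m := by
  rcases hl with rfl | rfl
  · rw [Filter.frequently_atTop]
    intro a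
    refine ⟨k * |a|, ?_, Dvd.intro _ rfl⟩
    have h1 : (1 : ℤ) ≤ k := by exact_mod_cast hk
    nlinarith [le_abs_self a, abs_nonneg a]
  · rw [Filter.frequently_atBot]
    intro a
    refine ⟨k * (-|a|), ?_, Dvd.intro _ rfl⟩
    have h1 : (1 : ℤ) ≤ k := by exact_mod_cast hk
    nlinarith [neg_abs_le a, abs_nonneg a]

lemma isEnd_atTop : IsEnd Filter.atTop := Or.inl rfl

lemma isEnd_atBot : IsEnd Filter.atBot := Or.inr rfl

lemma IsPeriodic.exists_dvd {w : W} {α : B → ℝ} (h : IsPeriodic ρ w α) :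
    ∃ k : ℕ, 1 ≤ k ∧ ∀ m : ℤ, (k : ℤ) ∣ m → ρ (w ^ m) α = α := by
  obtain ⟨k, hk, hα⟩ := h
  refine ⟨k, hk, ?_⟩
  have hpow : ∀ j : ℕ, ρ ((w ^ k) ^ j) α = α := by
    intro j
    induction j with
    | zero => rw [pow_zero, rho_one]
    | succ j ih => rw [pow_succ, rho_mul, hα, ih]
  rintro _ ⟨j, rfl⟩
  rw [zpow_mul, zpow_natCast]
  obtain ⟨j, rfl | rfl⟩ := j.eq_nat_or_neg
  · rw [zpow_natCast, hpow]
  · rw [zpow_neg, zpow_natCast]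
    nth_rw 1 [← hpow j]
    rw [rho_inv_rho]

lemma IsPeriodic.smul_add_smul {w : W} {α β : B → ℝ} (hα : IsPeriodic ρ w α)
    (hβ : IsPeriodic ρ w β) (a b : ℝ) : IsPeriodic ρ w (a • α + b • β) := by
  obtain ⟨k, hk, hα⟩ := hα.exists_dvd
  obtain ⟨j, hj, hβ⟩ := hβ.exists_dvd
  refine ⟨k * j, Nat.mul_pos hk hj, ?_⟩
  rw [← zpow_natCast, map_add, map_smul, map_smul, hα _ (by simp), hβ _ (by simp)]

lemma IsPeriodic.smul {w : W} {α : B → ℝ} (hα : IsPeriodic ρ w α) (a : ℝ) :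
    IsPeriodic ρ w (a • α) := by
  simpa using hα.smul_add_smul hα a 0

lemma isPeriodic_neg_iff {w : W} {α : B → ℝ} : IsPeriodic ρ w (-α) ↔ IsPeriodic ρ w α := by
  simp [IsPeriodic]

lemma isPeriodic_rho_zpow_iff {w : W} {α : B → ℝ} (n : ℤ) :
    IsPeriodic ρ w (ρ (w ^ n) α) ↔ IsPeriodic ρ w α := by
  refine exists_congr fun m => and_congr_right fun _ => ?_
  rw [← rho_mul, ← zpow_natCast, ← zpow_add, add_comm, zpow_add, rho_mul,
    EmbeddingLike.apply_eq_iff_eq]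

lemma injective_of_not_isPeriodic {w : W} {α : B → ℝ} (h : ¬ IsPeriodic ρ w α) :
    Function.Injective fun m : ℤ => ρ (w ^ m) α := by
  have key : ∀ m n : ℤ, m < n → ρ (w ^ m) α ≠ ρ (w ^ n) α := by
    intro m n hmn he
    obtain ⟨k, hk⟩ : ∃ k : ℕ, (k : ℤ) = n - m := ⟨(n - m).toNat, Int.toNat_of_nonneg (by omega)⟩
    refine h ⟨k, by omega, ?_⟩
    rw [← zpow_natCast, hk, sub_eq_neg_add, zpow_add, rho_mul, ← he, zpow_neg, rho_inv_rho]
  intro m n he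
  by_contra hne
  rcases lt_or_gt_of_ne hne with hlt | hlt
  · exact key m n hlt he
  · exact key n m hlt he.symm

/-- The signs of a nonperiodic root along `u * w ^ m` and `v * w ^ m` agree for almost all `m`. -/
lemma IsCanonical.eventually_isPos_iff (hρ : IsCanonical cs ρ) {w : W} {α : B → ℝ}
    (h : IsRoot ρ α) (hp : ¬ IsPeriodic ρ w α) (u v : W) :
    ∀ᶠ m : ℤ in Filter.cofinite, (IsPos (ρ (u * w ^ m) α) ↔ IsPos (ρ (v * w ^ m) α)) := by
  have hfin : ∀ u v : W, ∀ᶠ m : ℤ in Filter.cofinite,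
      IsPos (ρ (u * w ^ m) α) → IsPos (ρ (v * w ^ m) α) := by
    intro u v
    have := (hρ.finite_separating u v).preimage
      ((injective_of_not_isPeriodic hp).injOn (s := Set.univ) |>.mono (Set.subset_univ _))
    filter_upwards [this.compl_mem_cofinite] with m hm h1
    by_contra h2
    rw [rho_mul] at h1 h2
    exact hm ⟨h.map _, h1, (hρ.isPos_neg_iff ((h.map _).map v)).2 h2⟩
  filter_upwards [hfin u v, hfin v u] with m h1 h2
  exact ⟨h1, h2⟩

lemma EventuallyPos.mul_left (hρ : IsCanonical cs ρ) {w : W} {l : Filter ℤ} (hl : IsEnd l)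
    {α : B → ℝ} (hα : EventuallyPos ρ w l α) (h : IsRoot ρ α) (hp : ¬ IsPeriodic ρ w α) (v : W) :
    ∀ᶠ m in l, IsPos (ρ (v * w ^ m) α) := by
  filter_upwards [hα, hl.le_cofinite (hρ.eventually_isPos_iff h hp 1 v)] with m h1 h2
  rw [one_mul] at h2
  exact h2.1 h1

lemma IsCanonical.sepSet_eq (hρ : IsCanonical cs ρ) {w : W} {α : B → ℝ} (h : IsRoot ρ α) :
    sepSet ρ w α = {m : ℤ | ¬ (IsPos (ρ (w ^ m) α) ↔ IsPos (ρ (w ^ (m + 1)) α))} := by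
  ext m
  change _ ∧ IsPos _ ∨ IsPos _ ∧ _ ↔ ¬ _
  rw [hρ.isPos_neg_iff (h.map _), hρ.isPos_neg_iff (h.map _)]
  tauto

lemma IsCanonical.finite_signChanges (hρ : IsCanonical cs ρ) {w : W} {α : B → ℝ}
    (h : IsRoot ρ α) (hp : ¬ IsPeriodic ρ w α) :
    {m : ℤ | ¬ (IsPos (ρ (w ^ m) α) ↔ IsPos (ρ (w ^ (m + 1)) α))}.Finite := by
  have := hρ.eventually_isPos_iff h hp 1 w
  refine Set.Finite.subset (Filter.eventually_cofinite.1 this) fun m hm => ?_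
  change ¬ _
  rw [one_mul, ← zpow_one_add, add_comm]
  exact hm

lemma IsCanonical.eventuallyPos_neg_iff (hρ : IsCanonical cs ρ) {w : W} {l : Filter ℤ}
    (hl : IsEnd l) {α : B → ℝ} (h : IsRoot ρ α) (hp : ¬ IsPeriodic ρ w α) :
    EventuallyPos ρ w l (-α) ↔ ¬ EventuallyPos ρ w l α := by
  have := hl.neBot
  have hneg : ∀ m : ℤ, IsPos (ρ (w ^ m) (-α)) ↔ ¬ IsPos (ρ (w ^ m) α) := fun m => by
    rw [map_neg, hρ.isPos_neg_iff (h.map _)]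
  constructor
  · intro h1 h2
    obtain ⟨m, hm1, hm2⟩ := (h1.and h2).exists
    exact (hneg m).1 hm1 hm2
  · intro h1
    obtain ⟨N, hN1, hN2, -⟩ := exists_stabilization (hρ.finite_signChanges h hp)
    rcases hl with rfl | rfl
    · have hN : ¬ IsPos (ρ (w ^ N) α) := fun hN => h1 <| by
        filter_upwards [Filter.eventually_ge_atTop N] with m hm
        exact (hN1 m hm).2 hN
      filter_upwards [Filter.eventually_ge_atTop N] with m hm
      rwa [hneg, hN1 m hm]
    · have hN : ¬ IsPos (ρ (w ^ (-N)) α) := fun hN => h1 <| by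
        filter_upwards [Filter.eventually_le_atBot (-N)] with m hm
        exact (hN2 m hm).2 hN
      filter_upwards [Filter.eventually_le_atBot (-N)] with m hm
      rwa [hneg, hN2 m hm]

/-- A root is odd if and only if its signs at the two ends differ. -/
lemma IsCanonical.isWOdd_iff (hρ : IsCanonical cs ρ) {w : W} {α : B → ℝ} (h : IsRoot ρ α) :
    IsWOdd ρ w α ↔ ¬ IsPeriodic ρ w α ∧
      (EventuallyPos ρ w Filter.atTop α ↔ ¬ EventuallyPos ρ w Filter.atBot α) := by
  rw [IsWOdd, hρ.sepSet_eq h]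
  refine and_congr_right fun hp => ?_
  have hfin := hρ.finite_signChanges h hp
  rw [and_iff_right hfin]
  obtain ⟨N, hN1, hN2, hodd⟩ := exists_stabilization hfin
  rw [hodd]
  have htop : EventuallyPos ρ w Filter.atTop α ↔ IsPos (ρ (w ^ N) α) := by
    rw [EventuallyPos, Filter.eventually_congr (Filter.eventually_atTop.2 ⟨N, hN1⟩)]
    exact Filter.eventually_const
  have hbot : EventuallyPos ρ w Filter.atBot α ↔ IsPos (ρ (w ^ (-N)) α) := by
    rw [EventuallyPos, Filter.eventually_congr (Filter.eventually_atBot.2 ⟨-N, hN2⟩)]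
    exact Filter.eventually_const
  rw [htop, hbot]
  tauto

lemma IsCanonical.isWOdd_neg (hρ : IsCanonical cs ρ) {w : W} {α : B → ℝ} (h : IsRoot ρ α)
    (hα : IsWOdd ρ w α) : IsWOdd ρ w (-α) := by
  rw [hρ.isWOdd_iff h] at hα
  rw [hρ.isWOdd_iff (hρ.isRoot_neg h), isPeriodic_neg_iff,
    hρ.eventuallyPos_neg_iff isEnd_atTop h hα.1, hρ.eventuallyPos_neg_iff isEnd_atBot h hα.1]
  tauto

lemma eventuallyPos_rho_zpow_iff {w : W} {l : Filter ℤ} (hl : IsEnd l) {α : B → ℝ} (n : ℤ) :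
    EventuallyPos ρ w l (ρ (w ^ n) α) ↔ EventuallyPos ρ w l α := by
  have key : ∀ (n : ℤ) (α : B → ℝ), EventuallyPos ρ w l α →
      EventuallyPos ρ w l (ρ (w ^ n) α) := by
    intro n α h
    have ht : Filter.Tendsto (fun m : ℤ => m + n) l l := by
      rcases hl with rfl | rfl
      · exact Filter.tendsto_atTop_add_const_right _ _ Filter.tendsto_id
      · exact Filter.tendsto_atBot_add_const_right _ _ Filter.tendsto_id
    filter_upwards [ht.eventually h] with m hm
    rwa [← rho_mul, ← zpow_add]
  refine ⟨fun h => ?_, key n α⟩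
  have := key (-n) _ h
  rwa [zpow_neg, rho_inv_rho] at this

lemma IsCanonical.isWOdd_rho_zpow (hρ : IsCanonical cs ρ) {w : W} {α : B → ℝ} (h : IsRoot ρ α)
    (hα : IsWOdd ρ w α) (n : ℤ) : IsWOdd ρ w (ρ (w ^ n) α) := by
  rw [hρ.isWOdd_iff h] at hα
  rwa [hρ.isWOdd_iff (h.map _), isPeriodic_rho_zpow_iff, eventuallyPos_rho_zpow_iff isEnd_atTop,
    eventuallyPos_rho_zpow_iff isEnd_atBot]

/-- A periodic root is not a positive combination of two nonperiodic roots that are both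
positive at the same end. -/
lemma IsPeriodic.not_eventuallyPos (hρ : IsCanonical cs ρ) {w : W} {l : Filter ℤ} (hl : IsEnd l)
    {α γ δ : B → ℝ} (hα : IsPeriodic ρ w α) (hαr : IsRoot ρ α) (hγ : IsRoot ρ γ)
    (hγp : ¬ IsPeriodic ρ w γ) (hδ : IsRoot ρ δ) (hδp : ¬ IsPeriodic ρ w δ) {a b : ℝ} (ha : 0 ≤ a)
    (hb : 0 ≤ b) (he : α = a • γ + b • δ) (hγl : EventuallyPos ρ w l γ) :
    ¬ EventuallyPos ρ w l δ := by
  intro hδl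
  obtain ⟨k, hk, hper⟩ := hα.exists_dvd
  have key : ∀ v : W, IsPos (ρ v α) := by
    intro v
    obtain ⟨m, hm, h1, h2⟩ := ((hl.frequently_dvd hk).and_eventually
      ((hγl.mul_left hρ hl hγ hγp v).and (hδl.mul_left hρ hl hδ hδp v))).exists
    rw [← hper m hm, ← rho_mul, he, map_add, map_smul, map_smul]
    exact (h1.smul ha).add (h2.smul hb)
  have h1 := key 1
  have h2 := key (rootReflection cs ρ α)
  rw [rho_one] at h1
  rw [hρ.rho_rootReflection_self hαr] at h2
  exact hρ.not_isPos_neg hαr h1 h2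

/-- If `w` lies in a parabolic subgroup, then so do the reflections in the odd roots. -/
lemma IsCanonical.rootReflection_mem_of_isWOdd (hρ : IsCanonical cs ρ) {w v : W} {X : Set B}
    (hw : v⁻¹ * w * v ∈ standardParabolic cs X) {β : B → ℝ} (hβ : IsRoot ρ β)
    (hodd : IsWOdd ρ w β) : v⁻¹ * rootReflection cs ρ β * v ∈ standardParabolic cs X := by
  have e := hρ.rootReflection_map hβ v⁻¹
  rw [inv_inv] at e
  rw [← e]
  apply hρ.rootReflection_mem_standardParabolic (hβ.map _)
  intro t ht
  by_contra hne
  obtain ⟨hp, hiff⟩ := (hρ.isWOdd_iff hβ).1 hodd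
  have hcoord : ∀ m : ℤ, ρ (v⁻¹ * w ^ m) β t = ρ v⁻¹ β t := by
    intro m
    have hm : (v⁻¹ * w * v) ^ m ∈ standardParabolic cs X := Subgroup.zpow_mem _ hw m
    rw [← hρ.rho_apply_of_mem_standardParabolic hm (ρ v⁻¹ β) ht, ← rho_mul]
    have hc : (v⁻¹ * w * v) ^ m = v⁻¹ * w ^ m * v := by
      have := conj_zpow (i := m) (a := v⁻¹) (b := w)
      rwa [inv_inv] at this
    rw [hc, mul_inv_cancel_right]
  have hsign : ∀ m : ℤ, IsPos (ρ (v⁻¹ * w ^ m) β) ↔ 0 < ρ v⁻¹ β t := by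
    intro m
    constructor
    · intro h
      rw [← hcoord m]
      exact lt_of_le_of_ne (h t) (by rw [hcoord m]; exact Ne.symm hne)
    · intro h
      refine (hρ.isPos_or_isPos_neg (hβ.map _)).resolve_right fun h' => ?_
      have := h' t
      rw [Pi.neg_apply, hcoord m] at this
      linarith
  have hev : ∀ l, IsEnd l → (EventuallyPos ρ w l β ↔ 0 < ρ v⁻¹ β t) := by
    intro l hl
    have := hl.neBot
    have h1 := hl.le_cofinite (hρ.eventually_isPos_iff hβ hp 1 v⁻¹)
    rw [EventuallyPos, Filter.eventually_congr (p := fun m => IsPos (ρ (w ^ m) β))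
      (q := fun _ => 0 < ρ v⁻¹ β t)]
    · simp
    · filter_upwards [h1] with m hm
      rw [one_mul] at hm
      rw [hm, hsign]
  rw [hev _ isEnd_atTop, hev _ isEnd_atBot] at hiff
  tauto

/-! ### The subgroup generated by the odd reflections -/

/-- The subgroup generated by the reflections in the `w`-odd roots. -/
def oddSubgroup (cs : CoxeterSystem M W) (ρ : W →* ((B → ℝ) ≃ₗ[ℝ] (B → ℝ))) (w : W) :
    Subgroup W :=
  Subgroup.closure {t : W | ∃ (u : W) (s : B), t = u * cs.simple s * u⁻¹ ∧
    IsPos (ρ u (simpleRoot s)) ∧ IsWOdd ρ w (ρ u (simpleRoot s))}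

/-- A root whose reflection does not lie in the subgroup generated by the odd reflections. -/
structure IsStray (cs : CoxeterSystem M W) (ρ : W →* ((B → ℝ) ≃ₗ[ℝ] (B → ℝ))) (w : W)
    (α : B → ℝ) : Prop where
  isRoot : IsRoot ρ α
  notMem : rootReflection cs ρ α ∉ oddSubgroup cs ρ w

/-- A nonperiodic stray root which is positive at both ends. -/
structure IsStable (cs : CoxeterSystem M W) (ρ : W →* ((B → ℝ) ≃ₗ[ℝ] (B → ℝ))) (w : W)
    (α : B → ℝ) : Prop where
  isStray : IsStray cs ρ w α
  not_isPeriodic : ¬ IsPeriodic ρ w α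
  eventuallyPos : ∀ l, IsEnd l → EventuallyPos ρ w l α

lemma EventuallyPos.add {w : W} {l : Filter ℤ} {α β : B → ℝ} (hα : EventuallyPos ρ w l α)
    (hβ : EventuallyPos ρ w l β) : EventuallyPos ρ w l (α + β) := by
  filter_upwards [hα, hβ] with m h1 h2
  rw [map_add]
  exact h1.add h2

lemma EventuallyPos.smul {w : W} {l : Filter ℤ} {α : B → ℝ} (hα : EventuallyPos ρ w l α)
    {c : ℝ} (hc : 0 ≤ c) : EventuallyPos ρ w l (c • α) := by
  filter_upwards [hα] with m h
  rw [map_smul]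
  exact h.smul hc

lemma IsCanonical.exists_isEnd_eventuallyPos (hρ : IsCanonical cs ρ) {w : W} {β : B → ℝ}
    (h : IsRoot ρ β) (hβ : IsWOdd ρ w β) : ∃ l, IsEnd l ∧ EventuallyPos ρ w l β := by
  rw [hρ.isWOdd_iff h] at hβ
  by_cases hb : EventuallyPos ρ w Filter.atBot β
  · exact ⟨_, isEnd_atBot, hb⟩
  · exact ⟨_, isEnd_atTop, hβ.2.2 hb⟩

lemma IsCanonical.rootReflection_mem_oddSubgroup (hρ : IsCanonical cs ρ) {w : W} {β : B → ℝ}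
    (h : IsRoot ρ β) (hβ : IsWOdd ρ w β) : rootReflection cs ρ β ∈ oddSubgroup cs ρ w := by
  wlog hpos : IsPos β generalizing β
  · rw [← hρ.rootReflection_neg h]
    exact this (hρ.isRoot_neg h) (hρ.isWOdd_neg h hβ) ((hρ.isPos_neg_iff h).2 hpos)
  obtain ⟨u, s, rfl⟩ := h
  rw [hρ.rootReflection_map_simple]
  exact Subgroup.subset_closure ⟨u, s, rfl, hpos, hβ⟩

lemma IsStray.neg (hρ : IsCanonical cs ρ) {w : W} {α : B → ℝ} (h : IsStray cs ρ w α) :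
    IsStray cs ρ w (-α) :=
  ⟨hρ.isRoot_neg h.isRoot, by rw [hρ.rootReflection_neg h.isRoot]; exact h.notMem⟩

lemma IsStray.map (hρ : IsCanonical cs ρ) {w : W} {α : B → ℝ} (h : IsStray cs ρ w α) {g : W}
    (hg : g ∈ oddSubgroup cs ρ w) : IsStray cs ρ w (ρ g α) := by
  refine ⟨h.isRoot.map g, fun hm => h.notMem ?_⟩
  rwa [hρ.rootReflection_map h.isRoot, Subgroup.mul_mem_cancel_right _ (Subgroup.inv_mem _ hg),
    Subgroup.mul_mem_cancel_left _ hg] at hm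

lemma IsStray.isPeriodic_or (hρ : IsCanonical cs ρ) {w : W} {α : B → ℝ}
    (h : IsStray cs ρ w α) :
    IsPeriodic ρ w α ∨ IsStable cs ρ w α ∨ IsStable cs ρ w (-α) := by
  by_cases hp : IsPeriodic ρ w α
  · exact Or.inl hp
  have hodd : ¬ IsWOdd ρ w α := fun ho =>
    h.notMem (hρ.rootReflection_mem_oddSubgroup h.isRoot ho)
  rw [hρ.isWOdd_iff h.isRoot] at hodd
  by_cases hb : EventuallyPos ρ w Filter.atBot α
  · have ht : EventuallyPos ρ w Filter.atTop α := by tauto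
    exact Or.inr (Or.inl ⟨h, hp, by rintro l (rfl | rfl) <;> assumption⟩)
  · have ht : ¬ EventuallyPos ρ w Filter.atTop α := by tauto
    refine Or.inr (Or.inr ⟨h.neg hρ, isPeriodic_neg_iff.not.2 hp, ?_⟩)
    intro l hl
    rw [hρ.eventuallyPos_neg_iff hl h.isRoot hp]
    rcases hl with rfl | rfl <;> assumption

lemma IsStable.not_eventuallyPos_neg (hρ : IsCanonical cs ρ) {w : W} {α : B → ℝ}
    (h : IsStable cs ρ w α) {l : Filter ℤ} (hl : IsEnd l) : ¬ EventuallyPos ρ w l (-α) := by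
  rw [hρ.eventuallyPos_neg_iff hl h.isStray.isRoot h.not_isPeriodic, not_not]
  exact h.eventuallyPos l hl

lemma IsPeriodic.not_isStable_rootReflection (hρ : IsCanonical cs ρ) {w : W} {α β : B → ℝ}
    (hα : IsRoot ρ α) (hp : IsPeriodic ρ w α) (hβ : IsRoot ρ β) (hodd : IsWOdd ρ w β) :
    ¬ IsStable cs ρ w (ρ (rootReflection cs ρ β) α) := by
  wlog hpos : 0 ≤ canonicalForm M α β generalizing β
  · rw [← hρ.rootReflection_neg hβ]
    refine this (hρ.isRoot_neg hβ) (hρ.isWOdd_neg hβ hodd) ?_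
    rw [canonicalForm_neg_right]
    linarith
  intro hγ
  obtain ⟨l, hl, hβl⟩ := hρ.exists_isEnd_eventuallyPos hβ hodd
  refine hp.not_eventuallyPos hρ hl hα hγ.isStray.isRoot hγ.not_isPeriodic hβ hodd.1
    zero_le_one (b := 2 * canonicalForm M α β) (by linarith) ?_ (hγ.eventuallyPos l hl) hβl
  rw [hρ.rho_rootReflection hβ]
  module

/-- Periodic stray roots are orthogonal to odd roots. -/
lemma IsStray.form_eq_zero_of_isWOdd (hρ : IsCanonical cs ρ) {w : W} {α β : B → ℝ}
    (hα : IsStray cs ρ w α) (hp : IsPeriodic ρ w α) (hβ : IsRoot ρ β) (hodd : IsWOdd ρ w β) :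
    canonicalForm M α β = 0 := by
  by_contra hne
  rcases (hα.map hρ (hρ.rootReflection_mem_oddSubgroup hβ hodd)).isPeriodic_or hρ with h | h | h
  · apply hodd.1
    have := hp.smul_add_smul h (2 * canonicalForm M α β)⁻¹ (-(2 * canonicalForm M α β)⁻¹)
    have e : (2 * canonicalForm M α β)⁻¹ • α +
        (-(2 * canonicalForm M α β)⁻¹) • ρ (rootReflection cs ρ β) α = β := by
      rw [hρ.rho_rootReflection hβ]
      match_scalars
      · ring
      · field_simp
    rwa [e] at this
  · exact hp.not_isStable_rootReflection hρ hα.isRoot hβ hodd h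
  · rw [← map_neg] at h
    exact (isPeriodic_neg_iff.2 hp).not_isStable_rootReflection hρ (hα.neg hρ).isRoot hβ hodd h

lemma IsStable.map_of_isWOdd (hρ : IsCanonical cs ρ) {w : W} {α β : B → ℝ}
    (hα : IsStable cs ρ w α) (hβ : IsRoot ρ β) (hodd : IsWOdd ρ w β) :
    IsStable cs ρ w (ρ (rootReflection cs ρ β) α) := by
  wlog hneg : canonicalForm M α β ≤ 0 generalizing β
  · rw [← hρ.rootReflection_neg hβ]
    refine this (hρ.isRoot_neg hβ) (hρ.isWOdd_neg hβ hodd) ?_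
    rw [canonicalForm_neg_right]
    linarith
  have e := hρ.rho_rootReflection hβ α
  have hη := hα.isStray.map hρ (hρ.rootReflection_mem_oddSubgroup hβ hodd)
  rcases hη.isPeriodic_or hρ with h | h | h
  · have h0 := hη.form_eq_zero_of_isWOdd hρ h hβ hodd
    rw [e, canonicalForm_sub_left, canonicalForm_smul_left, hρ.form_self hβ] at h0
    have h0' : canonicalForm M α β = 0 := by linarith
    rw [e, h0', mul_zero, zero_smul, sub_zero] at h
    exact absurd h hα.not_isPeriodic
  · exact h
  · obtain ⟨l, hl, hβl⟩ := hρ.exists_isEnd_eventuallyPos hβ hodd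
    refine absurd ?_ (h.not_eventuallyPos_neg hρ hl)
    rw [neg_neg, e, sub_eq_add_neg, ← neg_smul]
    exact (hα.eventuallyPos l hl).add (hβl.smul (by linarith))

/-- The subgroup of all elements preserving the set of stable roots. -/
def stableStabilizer (cs : CoxeterSystem M W) (ρ : W →* ((B → ℝ) ≃ₗ[ℝ] (B → ℝ))) (w : W) :
    Subgroup W where
  carrier := {g | ∀ α, IsStable cs ρ w (ρ g α) ↔ IsStable cs ρ w α}
  one_mem' α := by rw [rho_one]
  mul_mem' {g h} hg hh α := by rw [rho_mul, hg, hh]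
  inv_mem' {g} hg α := by rw [← hg, rho_rho_inv]

lemma rootReflection_mem_stableStabilizer (hρ : IsCanonical cs ρ) {w : W} {β : B → ℝ}
    (hβ : IsRoot ρ β)
    (h : ∀ α, IsStable cs ρ w α → IsStable cs ρ w (ρ (rootReflection cs ρ β) α)) :
    rootReflection cs ρ β ∈ stableStabilizer cs ρ w := by
  refine fun α => ⟨fun hα => ?_, h α⟩
  have := h _ hα
  rwa [← rho_mul, hρ.rootReflection_mul_self hβ, rho_one] at this

lemma oddSubgroup_le_stableStabilizer (hρ : IsCanonical cs ρ) (w : W) :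
    oddSubgroup cs ρ w ≤ stableStabilizer cs ρ w := by
  refine (Subgroup.closure_le _).2 ?_
  rintro _ ⟨u, s, rfl, -, hodd⟩
  rw [← hρ.rootReflection_map_simple]
  exact rootReflection_mem_stableStabilizer hρ ⟨u, s, rfl⟩
    fun α hα => hα.map_of_isWOdd hρ ⟨u, s, rfl⟩ hodd

lemma IsStray.form_eq_zero (hρ : IsCanonical cs ρ) {w : W} {α η : B → ℝ}
    (hα : IsStray cs ρ w α) (hp : IsPeriodic ρ w α) (hη : IsRoot ρ η)
    (hm : rootReflection cs ρ η ∈ oddSubgroup cs ρ w) : canonicalForm M α η = 0 := by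
  have hfix : ∀ g ∈ oddSubgroup cs ρ w, ρ g α = α := by
    intro g hg
    induction hg using Subgroup.closure_induction with
    | mem g hg =>
      obtain ⟨u, s, rfl, -, hodd⟩ := hg
      rw [hρ.rho_conj_simple, hα.form_eq_zero_of_isWOdd hρ hp ⟨u, s, rfl⟩ hodd, mul_zero,
        zero_smul, sub_zero]
    | one => rw [rho_one]
    | mul g h _ _ ihg ihh => rw [rho_mul, ihh, ihg]
    | inv g _ ih => nth_rw 1 [← ih]; rw [rho_inv_rho]
  have h := hfix _ hm
  rw [hρ.rho_rootReflection hη, sub_eq_self, smul_eq_zero] at h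
  have := h.resolve_right (hρ.root_ne_zero hη)
  linarith

lemma IsStable.rootReflection_of_form_neg (hρ : IsCanonical cs ρ) {w : W} {α γ : B → ℝ}
    (hα : IsStable cs ρ w α) (hγ : IsStable cs ρ w γ) (hneg : canonicalForm M γ α < 0) :
    IsStable cs ρ w (ρ (rootReflection cs ρ α) γ) := by
  have hαr := hα.isStray.isRoot
  have hγr := hγ.isStray.isRoot
  set η := ρ (rootReflection cs ρ α) γ with hη
  obtain ⟨p, hp⟩ : ∃ p, p = -canonicalForm M γ α := ⟨_, rfl⟩
  have hp0 : 0 < p := by linarith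
  have hγα : canonicalForm M γ α = -p := by linarith
  have e : η = γ + (2 * p) • α := by
    rw [hη, hρ.rho_rootReflection hαr, hγα]
    module
  have hηr : IsRoot ρ η := hγr.map _
  by_cases hm : rootReflection cs ρ η ∈ oddSubgroup cs ρ w
  · have hY := oddSubgroup_le_stableStabilizer hρ w hm
    have hαη : canonicalForm M α η = p := by
      rw [e, canonicalForm_add_right, canonicalForm_smul_right, canonicalForm_comm M α γ, hγα,
        hρ.form_self hαr]
      ring
    have hγη : canonicalForm M γ η = 1 - 2 * p ^ 2 := by
      rw [e, canonicalForm_add_right, canonicalForm_smul_right, hγα, hρ.form_self hγr]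
      ring
    exfalso
    rcases le_or_gt 1 (4 * p ^ 2) with hp1 | hp1
    · refine ((hY α).2 hα).not_eventuallyPos_neg hρ isEnd_atTop ?_
      have : -ρ (rootReflection cs ρ η) α = (4 * p ^ 2 - 1) • α + (2 * p) • γ := by
        rw [hρ.rho_rootReflection hηr, hαη, e]
        module
      rw [this]
      exact ((hα.eventuallyPos _ isEnd_atTop).smul (by linarith)).add
        ((hγ.eventuallyPos _ isEnd_atTop).smul (by linarith))
    · refine ((hY γ).2 hγ).not_eventuallyPos_neg hρ isEnd_atTop ?_
      have : -ρ (rootReflection cs ρ η) γ =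
          (1 - 4 * p ^ 2) • γ + (4 * p * (1 - 2 * p ^ 2)) • α := by
        rw [hρ.rho_rootReflection hηr, hγη, e]
        module
      rw [this]
      refine ((hγ.eventuallyPos _ isEnd_atTop).smul (by linarith)).add
        ((hα.eventuallyPos _ isEnd_atTop).smul (mul_nonneg (by linarith) (by linarith)))
  · rcases IsStray.isPeriodic_or hρ ⟨hηr, hm⟩ with h | h | h
    · refine absurd (hα.eventuallyPos _ isEnd_atTop) (h.not_eventuallyPos hρ isEnd_atTop hηr hγr
        hγ.not_isPeriodic hαr hα.not_isPeriodic zero_le_one (b := 2 * p) (by linarith) ?_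
        (hγ.eventuallyPos _ isEnd_atTop))
      rw [one_smul, e]
    · exact h
    · refine absurd ?_ (h.not_eventuallyPos_neg hρ isEnd_atTop)
      rw [neg_neg, e]
      exact (hγ.eventuallyPos _ isEnd_atTop).add
        ((hα.eventuallyPos _ isEnd_atTop).smul (by linarith))

lemma IsStable.rootReflection_of_isPeriodic (hρ : IsCanonical cs ρ) {w : W} {α γ : B → ℝ}
    (hα : IsStray cs ρ w α) (hp : IsPeriodic ρ w α) (hγ : IsStable cs ρ w γ) :
    IsStable cs ρ w (ρ (rootReflection cs ρ α) γ) := by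
  wlog hpos : 0 ≤ canonicalForm M γ α generalizing α
  · rw [← hρ.rootReflection_neg hα.isRoot]
    refine this (hα.neg hρ) (isPeriodic_neg_iff.2 hp) ?_
    rw [canonicalForm_neg_right]
    linarith
  have hαr := hα.isRoot
  have hγr := hγ.isStray.isRoot
  set η := ρ (rootReflection cs ρ α) γ with hη
  have e : η = γ - (2 * canonicalForm M γ α) • α := hρ.rho_rootReflection hαr γ
  have hηr : IsRoot ρ η := hγr.map _
  rcases hpos.eq_or_lt with h0 | hpos
  · rw [← h0, mul_zero, zero_smul, sub_zero] at e
    rwa [e]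
  by_cases hm : rootReflection cs ρ η ∈ oddSubgroup cs ρ w
  · have h0 := hα.form_eq_zero hρ hp hηr hm
    rw [e, canonicalForm_sub_right, canonicalForm_smul_right, hρ.form_self hαr,
      canonicalForm_comm M α γ] at h0
    linarith
  rcases IsStray.isPeriodic_or hρ ⟨hηr, hm⟩ with h | h | h
  · refine absurd ?_ hγ.not_isPeriodic
    have := h.smul_add_smul hp 1 (2 * canonicalForm M γ α)
    rwa [e, one_smul, sub_add_cancel] at this
  · exact h
  · refine absurd (h.eventuallyPos _ isEnd_atTop) (hp.not_eventuallyPos hρ isEnd_atTop hαr hγr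
      hγ.not_isPeriodic h.isStray.isRoot h.not_isPeriodic
      (a := (2 * canonicalForm M γ α)⁻¹) (b := (2 * canonicalForm M γ α)⁻¹)
      (by positivity) (by positivity) ?_ (hγ.eventuallyPos _ isEnd_atTop))
    rw [e]
    match_scalars
    · field_simp
    · ring

/-! ### A chamber on which all stable roots are positive -/

lemma IsCanonical.conj_zpow_mem_oddSubgroup (hρ : IsCanonical cs ρ) {w g : W}
    (hg : g ∈ oddSubgroup cs ρ w) (n : ℤ) : w ^ n * g * (w ^ n)⁻¹ ∈ oddSubgroup cs ρ w := by
  induction hg using Subgroup.closure_induction with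
  | mem g hg =>
    obtain ⟨u, s, rfl, -, hodd⟩ := hg
    rw [← hρ.rootReflection_map_simple, ← hρ.rootReflection_map ⟨u, s, rfl⟩]
    exact hρ.rootReflection_mem_oddSubgroup (IsRoot.map ⟨u, s, rfl⟩ _)
      (hρ.isWOdd_rho_zpow ⟨u, s, rfl⟩ hodd n)
  | one => simp
  | mul g h _ _ ihg ihh =>
    rw [← conj_mul]
    exact mul_mem ihg ihh
  | inv g _ ih =>
    rw [← conj_inv]
    exact inv_mem ih

lemma IsStable.rho_zpow (hρ : IsCanonical cs ρ) {w : W} {α : B → ℝ} (h : IsStable cs ρ w α)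
    (n : ℤ) : IsStable cs ρ w (ρ (w ^ n) α) := by
  have hr := h.isStray.isRoot
  refine ⟨⟨hr.map _, fun hm => h.isStray.notMem ?_⟩, (isPeriodic_rho_zpow_iff n).not.2
    h.not_isPeriodic, fun l hl => (eventuallyPos_rho_zpow_iff hl n).2 (h.eventuallyPos l hl)⟩
  rw [hρ.rootReflection_map hr] at hm
  have := hρ.conj_zpow_mem_oddSubgroup hm (-n)
  rw [zpow_neg] at this
  simpa [mul_assoc] using this

lemma IsCanonical.self_mem_stableStabilizer (hρ : IsCanonical cs ρ) (w : W) :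
    w ∈ stableStabilizer cs ρ w := by
  refine fun α => ⟨fun h => ?_, fun h => ?_⟩
  · have := h.rho_zpow hρ (-1)
    rwa [zpow_neg_one, rho_inv_rho] at this
  · have := h.rho_zpow hρ 1
    rwa [zpow_one] at this

lemma IsStable.finite_zpow (hρ : IsCanonical cs ρ) {w : W} {δ : B → ℝ} (h : IsStable cs ρ w δ)
    (v : W) : {m : ℤ | IsPos (-ρ (v * w ^ m) δ)}.Finite := by
  have hr := h.isStray.isRoot
  have hev : ∀ᶠ m : ℤ in Filter.cofinite, IsPos (ρ (v * w ^ m) δ) := by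
    rw [Int.cofinite_eq]
    exact Filter.eventually_sup.2
      ⟨(h.eventuallyPos _ isEnd_atBot).mul_left hρ isEnd_atBot hr h.not_isPeriodic v,
        (h.eventuallyPos _ isEnd_atTop).mul_left hρ isEnd_atTop hr h.not_isPeriodic v⟩
  refine Set.Finite.subset (Filter.eventually_cofinite.1 hev) fun m hm => ?_
  exact (hρ.isPos_neg_iff (hr.map _)).1 hm

lemma IsCanonical.finite_negative_stable (hρ : IsCanonical cs ρ) (w v : W) :
    {α : B → ℝ | IsStable cs ρ w α ∧ IsPos (-ρ v α)}.Finite := by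
  set F := {δ : B → ℝ | IsRoot ρ δ ∧ IsPos (ρ (v * w) δ) ∧ IsPos (-ρ v δ)} ∩
    {δ | IsStable cs ρ w δ}
  have hF : F.Finite := (hρ.finite_separating (v * w) v).inter_of_left _
  refine (hF.biUnion (t := fun δ => (fun m : ℤ => ρ (w ^ m) δ) '' {m | IsPos (-ρ (v * w ^ m) δ)})
    fun δ hδ => (hδ.2.finite_zpow hρ v).image _).subset ?_
  rintro α ⟨hα, hneg⟩
  have hr := hα.isStray.isRoot
  have hex : ∃ n : ℕ, IsPos (ρ (v * w ^ n) α) := by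
    have := (hα.eventuallyPos _ isEnd_atTop).mul_left hρ isEnd_atTop hr hα.not_isPeriodic v
    obtain ⟨N, hN⟩ := Filter.eventually_atTop.1 this
    refine ⟨N.toNat, ?_⟩
    rw [← zpow_natCast]
    exact hN _ (Int.self_le_toNat N)
  classical
  obtain ⟨n, hn⟩ : ∃ n, n + 1 = Nat.find hex := by
    refine Nat.exists_add_one_eq.2 (Nat.pos_of_ne_zero fun h0 => ?_)
    have := Nat.find_spec hex
    rw [h0, pow_zero, mul_one] at this
    exact hρ.not_isPos_neg (hr.map v) this hneg
  have hpos := Nat.find_spec hex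
  have hn1 : ¬ IsPos (ρ (v * w ^ n) α) := Nat.find_min hex (by omega)
  rw [← hn] at hpos
  have hα' : ρ (w ^ (-(n : ℤ))) (ρ (w ^ n) α) = α := by
    rw [zpow_neg, zpow_natCast, rho_inv_rho]
  refine Set.mem_biUnion (x := ρ (w ^ n) α) ⟨⟨hr.map _, ?_, ?_⟩, ?_⟩ ⟨-(n : ℤ), ?_, hα'⟩
  · rwa [← rho_mul, mul_assoc, ← pow_succ']
  · rwa [hρ.isPos_neg_iff ((hr.map _).map _), ← rho_mul]
  · have := hα.rho_zpow hρ n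
    rwa [zpow_natCast] at this
  · change IsPos _
    rwa [rho_mul, hα']

lemma IsCanonical.exists_not_isStable_neg_simple (hρ : IsCanonical cs ρ) (w : W) :
    ∃ x : W, ∀ s, ¬ IsStable cs ρ w (-ρ x (simpleRoot s)) := by
  set N : W → Set (B → ℝ) := fun x => {α | IsStable cs ρ w α ∧ IsPos (-ρ x⁻¹ α)} with hN
  refine ⟨Function.argmin fun x => (N x).ncard, fun s hs => ?_⟩
  set x := Function.argmin fun x => (N x).ncard with hx
  have hsimple := isRoot_simpleRoot ρ s
  refine (Set.ncard_lt_ncard (s := N (x * cs.simple s)) (t := N x) ?_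
    (hρ.finite_negative_stable w _)).not_ge (Function.argmin_le (fun x => (N x).ncard) _)
  refine (Set.ssubset_iff_of_subset ?_).2 ⟨-ρ x (simpleRoot s), ⟨hs, ?_⟩, fun h => ?_⟩
  · rintro α ⟨hα, h⟩
    refine ⟨hα, ?_⟩
    have hr := hα.isStray.isRoot
    rw [hρ.isPos_neg_iff (hr.map _)]
    intro hpos
    rw [mul_inv_rev, cs.inv_simple, rho_mul] at h
    have e := hρ.eq_simpleRoot (hr.map _) hpos h
    have e' : α = ρ x (simpleRoot s) := by rw [← e, rho_rho_inv]
    rw [← e'] at hs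
    refine hs.not_eventuallyPos_neg hρ isEnd_atTop ?_
    rw [neg_neg]
    exact hα.eventuallyPos _ isEnd_atTop
  · rw [map_neg, neg_neg, rho_inv_rho]
    exact isPos_simpleRoot s
  · have h2 := h.2
    rw [map_neg, neg_neg, mul_inv_rev, rho_mul, rho_inv_rho, cs.inv_simple,
      hρ.rho_simple_self] at h2
    exact hρ.not_isPos_neg hsimple (isPos_simpleRoot s) h2

lemma IsStray.rootReflection_mem_stableStabilizer (hρ : IsCanonical cs ρ) {w : W} {α : B → ℝ}
    (hα : IsStray cs ρ w α) (hp : IsPeriodic ρ w α) :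
    rootReflection cs ρ α ∈ stableStabilizer cs ρ w :=
  CoxeterPaper.rootReflection_mem_stableStabilizer hρ hα.isRoot
    fun _ hγ => hγ.rootReflection_of_isPeriodic hρ hα hp

lemma IsStable.isPos_of_chamber (hρ : IsCanonical cs ρ) {w x : W}
    (hx : ∀ s, ¬ IsStable cs ρ w (-ρ x (simpleRoot s))) {γ : B → ℝ} (hγ : IsStable cs ρ w γ) :
    IsPos (ρ x⁻¹ γ) := by
  have key : ∀ β, IsRoot ρ β → IsPos β → ¬ IsStable cs ρ w (-ρ x β) := by
    intro β hβ hβpos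
    refine hρ.root_induction (p := fun β => ¬ IsStable cs ρ w (-ρ x β)) hx ?_ hβ hβpos
    intro γ s hγ _ hform _ hnot hst
    have hxs : IsRoot ρ (ρ x (simpleRoot s)) := ⟨x, s, rfl⟩
    have e : ρ (rootReflection cs ρ (ρ x (simpleRoot s))) (-ρ x γ) =
        -ρ x (ρ (cs.simple s) γ) := by
      rw [hρ.rootReflection_map_simple, map_neg, rho_mul, rho_mul, rho_inv_rho]
    refine hnot (e ▸ ?_)
    by_cases hm : rootReflection cs ρ (ρ x (simpleRoot s)) ∈ oddSubgroup cs ρ w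
    · exact (oddSubgroup_le_stableStabilizer hρ w hm _).2 hst
    have hstray : IsStray cs ρ w (ρ x (simpleRoot s)) := ⟨hxs, hm⟩
    rcases hstray.isPeriodic_or hρ with h | h | h
    · exact (hstray.rootReflection_mem_stableStabilizer hρ h _).2 hst
    · refine h.rootReflection_of_form_neg hρ hst ?_
      rw [canonicalForm_neg_left, hρ.form_rho]
      linarith
    · exact absurd h (hx s)
  have hr := hγ.isStray.isRoot
  by_contra hneg
  have := key (-ρ x⁻¹ γ) (hρ.isRoot_neg (hr.map _)) ((hρ.isPos_neg_iff (hr.map _)).2 hneg)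
  rw [map_neg, neg_neg, rho_rho_inv] at this
  exact this hγ

lemma IsCanonical.mem_oddSubgroup_or_isPeriodic (hρ : IsCanonical cs ρ) {w x : W}
    (hx : ∀ s, ¬ IsStable cs ρ w (-ρ x (simpleRoot s))) {s : B}
    (hs : ¬ IsStable cs ρ w (ρ x (simpleRoot s))) :
    x * cs.simple s * x⁻¹ ∈ oddSubgroup cs ρ w ∨
      IsStray cs ρ w (ρ x (simpleRoot s)) ∧ IsPeriodic ρ w (ρ x (simpleRoot s)) := by
  rw [← hρ.rootReflection_map_simple]
  by_cases hm : rootReflection cs ρ (ρ x (simpleRoot s)) ∈ oddSubgroup cs ρ w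
  · exact Or.inl hm
  have hstray : IsStray cs ρ w (ρ x (simpleRoot s)) := ⟨⟨x, s, rfl⟩, hm⟩
  exact Or.inr ⟨hstray, ((hstray.isPeriodic_or hρ).resolve_right
    (not_or.2 ⟨hs, hx s⟩))⟩

lemma IsCanonical.mem_standardParabolic_of_conj_mem (hρ : IsCanonical cs ρ) {w x : W}
    (hx : ∀ s, ¬ IsStable cs ρ w (-ρ x (simpleRoot s))) {y : W}
    (hy : x * y * x⁻¹ ∈ stableStabilizer cs ρ w) :
    y ∈ standardParabolic cs {s | ¬ IsStable cs ρ w (ρ x (simpleRoot s))} := by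
  induction hn : cs.length y using Nat.strong_induction_on generalizing y with
  | _ n ih =>
  subst hn
  by_cases hy1 : y = 1
  · rw [hy1]
    exact one_mem _
  obtain ⟨s, hs⟩ := cs.exists_rightDescent_of_ne_one hy1
  have hsX : ¬ IsStable cs ρ w (ρ x (simpleRoot s)) := by
    intro h
    have h1 := ((hy _).2 h).isPos_of_chamber hρ hx
    rw [rho_mul, rho_mul, rho_inv_rho, rho_inv_rho] at h1
    exact hρ.not_isPos_neg (IsRoot.map (isRoot_simpleRoot ρ s) y) h1
      (hρ.isPos_neg_of_length_lt hs)
  have hsY : x * cs.simple s * x⁻¹ ∈ stableStabilizer cs ρ w := by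
    rcases hρ.mem_oddSubgroup_or_isPeriodic hx hsX with h | ⟨h, hp⟩
    · exact oddSubgroup_le_stableStabilizer hρ w h
    · rw [← hρ.rootReflection_map_simple]
      exact h.rootReflection_mem_stableStabilizer hρ hp
  have hmem := ih _ hs (y := y * cs.simple s) (by
    have := mul_mem hy hsY
    rwa [conj_mul] at this) rfl
  have := mul_mem hmem (simple_mem_standardParabolic hsX)
  rwa [mul_assoc, cs.simple_mul_simple_self, mul_one] at this

lemma mem_map_conj_iff {H : Subgroup W} {v g : W} :
    g ∈ H.map (MulAut.conj v).toMonoidHom ↔ v⁻¹ * g * v ∈ H := by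
  rw [Subgroup.mem_map]
  constructor
  · rintro ⟨h, hh, rfl⟩
    simpa [mul_assoc] using hh
  · intro h
    exact ⟨_, h, by simp [mul_assoc]⟩

lemma IsEssential.eq_univ (hρ : IsCanonical cs ρ) {w v : W} (hw : IsEssential cs w) {X : Set B}
    (h : v⁻¹ * w * v ∈ standardParabolic cs X) : X = Set.univ := by
  apply hρ.eq_univ_of_standardParabolic_eq_top
  by_contra hne
  refine hw _ ⟨v, X, rfl⟩ (fun htop => hne ?_) (mem_map_conj_iff.2 h)
  refine (Subgroup.eq_top_iff' _).2 fun g => ?_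
  have : v * g * v⁻¹ ∈ (standardParabolic cs X).map (MulAut.conj v).toMonoidHom :=
    htop ▸ Subgroup.mem_top _
  simpa [mul_assoc] using mem_map_conj_iff.1 this

lemma eq_top_of_conj_simple_mem {H : Subgroup W} {x : W}
    (h : ∀ s, x * cs.simple s * x⁻¹ ∈ H) : H = ⊤ := by
  have hle : (⊤ : Subgroup W) ≤ H.comap (MulAut.conj x).toMonoidHom := by
    rw [← cs.subgroup_closure_range_simple, Subgroup.closure_le]
    rintro _ ⟨s, rfl⟩
    exact h s
  refine (Subgroup.eq_top_iff' _).2 fun g => ?_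
  have := hle (Subgroup.mem_top (x⁻¹ * g * x))
  simpa [mul_assoc] using this

lemma coxeterGraph_adj_iff {s t : B} :
    (coxeterGraph M).Adj s t ↔ s ≠ t ∧ (M s t = 0 ∨ 3 ≤ M s t) := by
  rw [coxeterGraph, SimpleGraph.fromRel_adj, M.symmetric s t, or_self]

lemma IsEssential.oddSubgroup_eq_top_or (hρ : IsCanonical cs ρ) (hirr : (coxeterGraph M).Connected)
    {w : W} (hw : IsEssential cs w) :
    oddSubgroup cs ρ w = ⊤ ∨ ∃ k : ℕ, 1 ≤ k ∧ w ^ k = 1 := by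
  obtain ⟨x, hx⟩ := hρ.exists_not_isStable_neg_simple w
  have hX := hw.eq_univ hρ (v := x) (hρ.mem_standardParabolic_of_conj_mem hx (by
    simpa [mul_assoc] using hρ.self_mem_stableStabilizer w))
  have hor := fun s => hρ.mem_oddSubgroup_or_isPeriodic hx (s := s) ((Set.eq_univ_iff_forall.1 hX) s)
  have hadj : ∀ s t, (coxeterGraph M).Adj s t → x * cs.simple s * x⁻¹ ∈ oddSubgroup cs ρ w →
      x * cs.simple t * x⁻¹ ∈ oddSubgroup cs ρ w := by
    intro s t hst hs
    refine (hor t).resolve_right fun ⟨hstray, hp⟩ => ?_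
    rw [← hρ.rootReflection_map_simple] at hs
    have h0 := hstray.form_eq_zero hρ hp ⟨x, s, rfl⟩ hs
    rw [hρ.form_rho, canonicalForm_simpleRoot] at h0
    have h2 := eq_two_of_formEntry_eq_zero M h0
    have := (coxeterGraph_adj_iff.1 hst.symm).2
    omega
  by_cases hall : ∃ s, x * cs.simple s * x⁻¹ ∈ oddSubgroup cs ρ w
  · obtain ⟨s, hs⟩ := hall
    refine Or.inl (eq_top_of_conj_simple_mem (cs := cs) (x := x) fun t => ?_)
    obtain ⟨p⟩ := hirr.preconnected s t
    induction p with
    | nil => exact hs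
    | cons h _ ih => exact ih (hadj _ _ h hs)
  · push Not at hall
    right
    choose k hk hper using fun s => ((hor s).resolve_left (hall s)).2.exists_dvd
    refine ⟨∏ s, k s, Nat.one_le_iff_ne_zero.2 (Finset.prod_ne_zero_iff.2 fun s _ =>
      Nat.one_le_iff_ne_zero.1 (hk s)), ?_⟩
    have h1 : x⁻¹ * w ^ (∏ s, k s) * x = 1 := by
      apply hρ.eq_one
      intro s
      have hdvd : (k s : ℤ) ∣ (∏ s, k s : ℕ) :=
        Int.natCast_dvd_natCast.2 (Finset.dvd_prod_of_mem k (Finset.mem_univ s))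
      have := hper s _ hdvd
      rw [zpow_natCast] at this
      rw [rho_mul, rho_mul, this, rho_inv_rho]
    rw [mul_assoc, inv_mul_eq_one] at h1
    exact right_eq_mul.1 h1

/-! ### Elements of finite order -/

lemma linearMap_apply_eq_sum (f : (B → ℝ) →ₗ[ℝ] ℝ) (x : B → ℝ) :
    f x = ∑ t, x t * f (simpleRoot t) := by
  conv_lhs => rw [← Finset.univ_sum_single x, map_sum]
  refine Finset.sum_congr rfl fun t _ => ?_
  rw [← smul_eq_mul, ← map_smul]
  congr 1
  rw [simpleRoot, ← Pi.single_smul, smul_eq_mul, mul_one]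

/-- The stabilizer of a dominant linear functional is a standard parabolic subgroup. -/
lemma IsCanonical.mem_standardParabolic_of_invariant (hρ : IsCanonical cs ρ)
    {f : (B → ℝ) →ₗ[ℝ] ℝ} (hf : ∀ s, 0 ≤ f (simpleRoot s)) {g : W} (hg : ∀ x, f (ρ g x) = f x) :
    g ∈ standardParabolic cs {s | f (simpleRoot s) = 0} := by
  induction hn : cs.length g using Nat.strong_induction_on generalizing g with
  | _ n ih =>
  subst hn
  by_cases hg1 : g = 1
  · rw [hg1]
    exact one_mem _
  obtain ⟨s, hs⟩ := cs.exists_rightDescent_of_ne_one hg1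
  have hs0 : f (simpleRoot s) = 0 := by
    refine le_antisymm ?_ (hf s)
    have : 0 ≤ f (-ρ g (simpleRoot s)) := by
      rw [linearMap_apply_eq_sum]
      exact Finset.sum_nonneg fun t _ => mul_nonneg (hρ.isPos_neg_of_length_lt hs t) (hf t)
    rw [map_neg, hg] at this
    linarith
  have hmem := ih _ hs (g := g * cs.simple s) (fun x => by
    rw [rho_mul, hg, hρ, map_sub, map_smul, hs0, smul_zero, sub_zero]) rfl
  have := mul_mem hmem (simple_mem_standardParabolic (X := {s | f (simpleRoot s) = 0}) hs0)
  rwa [mul_assoc, cs.simple_mul_simple_self, mul_one] at this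

/-- A functional which is negative on only finitely many positive roots can be moved to a
dominant one. -/
lemma IsCanonical.exists_dominant (hρ : IsCanonical cs ρ) {f : (B → ℝ) →ₗ[ℝ] ℝ}
    (hf : ∀ u, {β : B → ℝ | IsRoot ρ β ∧ IsPos β ∧ f (ρ u β) < 0}.Finite) :
    ∃ u : W, ∀ s, 0 ≤ f (ρ u (simpleRoot s)) := by
  set N : W → Set (B → ℝ) := fun u => {β | IsRoot ρ β ∧ IsPos β ∧ f (ρ u β) < 0} with hN
  refine ⟨Function.argmin fun u => (N u).ncard, fun s => ?_⟩
  set u := Function.argmin fun u => (N u).ncard with hu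
  by_contra! hneg
  have hsimple := isRoot_simpleRoot ρ s
  refine (?_ : (N (u * cs.simple s)).ncard < (N u).ncard).not_ge
    (Function.argmin_le (fun u => (N u).ncard) _)
  rw [← Set.ncard_image_of_injective (N (u * cs.simple s)) (ρ (cs.simple s)).injective]
  refine Set.ncard_lt_ncard ((Set.ssubset_iff_of_subset ?_).2
    ⟨simpleRoot s, ⟨hsimple, isPos_simpleRoot s, hneg⟩, ?_⟩) (hf u)
  · rintro _ ⟨β, ⟨hβ, hpos, hlt⟩, rfl⟩
    refine ⟨hβ.map _, ?_, by rwa [← rho_mul]⟩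
    by_contra hn
    have e := hρ.eq_simpleRoot hβ hpos ((hρ.isPos_neg_iff (hβ.map _)).2 hn)
    rw [e, hρ.rho_mul_simple, map_neg] at hlt
    linarith
  · rintro ⟨β, ⟨hβ, hpos, hlt⟩, e⟩
    have e' : β = -simpleRoot s := by
      rw [← hρ.rho_simple_self, ← e, ← rho_mul, cs.simple_mul_simple_self, rho_one]
    rw [e'] at hpos
    exact hρ.not_isPos_neg hsimple (isPos_simpleRoot s) hpos

lemma IsCanonical.infinite_positive_roots (hρ : IsCanonical cs ρ) [Infinite W] :
    {β : B → ℝ | IsRoot ρ β ∧ IsPos β}.Infinite := by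
  intro hfin
  have hroots : {β : B → ℝ | IsRoot ρ β}.Finite := by
    refine (hfin.union (hfin.image Neg.neg)).subset fun β hβ => ?_
    rcases hρ.isPos_or_isPos_neg hβ with h | h
    · exact Or.inl ⟨hβ, h⟩
    · exact Or.inr ⟨-β, ⟨hρ.isRoot_neg hβ, h⟩, neg_neg β⟩
  have := hroots.to_subtype
  let F : W → B → {β : B → ℝ | IsRoot ρ β} := fun u s => ⟨ρ u (simpleRoot s), u, s, rfl⟩
  refine not_finite_iff_infinite.2 ‹Infinite W› (Finite.of_injective F fun u v huv => ?_)
  rw [← inv_mul_eq_one]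
  apply hρ.eq_one
  intro s
  have h : ρ u (simpleRoot s) = ρ v (simpleRoot s) := congrArg Subtype.val (congrFun huv s)
  rw [rho_mul, ← h, rho_inv_rho]

/-- In an infinite Coxeter group, elements of finite order are not essential. -/
lemma IsCanonical.not_isEssential_of_pow_eq_one (hρ : IsCanonical cs ρ) [Infinite W] {w : W}
    {k : ℕ} (hk : w ^ k = 1) (hk1 : 1 ≤ k) : ¬ IsEssential cs w := by
  intro hw
  set ht : (B → ℝ) →ₗ[ℝ] ℝ := ∑ t, LinearMap.proj t with hht
  have ht_apply : ∀ x, ht x = ∑ t, x t := fun x => by simp [hht]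
  set f : (B → ℝ) →ₗ[ℝ] ℝ := ∑ i ∈ Finset.range k, ht ∘ₗ (ρ (w ^ i)).toLinearMap with hf
  have f_apply : ∀ x, f x = ∑ i ∈ Finset.range k, ht (ρ (w ^ i) x) := fun x => by
    rw [hf, LinearMap.sum_apply]
    rfl
  have hinv : ∀ x, f (ρ w x) = f x := by
    intro x
    have h1 := Finset.sum_range_succ (fun i => ht (ρ (w ^ i) x)) k
    rw [Finset.sum_range_succ', hk, pow_zero] at h1
    rw [f_apply, f_apply]
    simp_rw [← rho_mul, ← pow_succ]
    linarith
  have hnonneg : ∀ x, IsPos x → 0 ≤ ht x := fun x hx => by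
    rw [ht_apply]
    exact Finset.sum_nonneg fun t _ => hx t
  have hfin : ∀ u : W, {β : B → ℝ | IsRoot ρ β ∧ IsPos β ∧ f (ρ u β) < 0}.Finite := by
    intro u
    refine (Set.finite_iUnion fun i : Fin k => hρ.finite_inversions (w ^ (i : ℕ) * u)).subset ?_
    rintro β ⟨hβ, hpos, hlt⟩
    by_contra hn
    refine hlt.not_ge ?_
    rw [f_apply]
    refine Finset.sum_nonneg fun i hi => hnonneg _ ?_
    by_contra hneg
    refine hn (Set.mem_iUnion.2 ⟨⟨i, Finset.mem_range.1 hi⟩, hβ, hpos, ?_⟩)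
    rwa [hρ.isPos_neg_iff (hβ.map _), rho_mul]
  obtain ⟨u, hu⟩ := hρ.exists_dominant hfin
  have hX := hw.eq_univ hρ (v := u) (hρ.mem_standardParabolic_of_invariant
    (f := f ∘ₗ (ρ u).toLinearMap) hu fun x => by
      change f (ρ u (ρ (u⁻¹ * w * u) x)) = f (ρ u x)
      rw [← rho_mul, mul_assoc, mul_inv_cancel_left, rho_mul, hinv])
  have hzero : ∀ x, f x = 0 := by
    intro x
    have h := linearMap_apply_eq_sum (f ∘ₗ (ρ u).toLinearMap) (ρ u⁻¹ x)
    rw [Finset.sum_eq_zero fun t _ => by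
      have : t ∈ {s | (f ∘ₗ (ρ u).toLinearMap) (simpleRoot s) = 0} := hX ▸ Set.mem_univ t
      rw [this, mul_zero]] at h
    change f (ρ u (ρ u⁻¹ x)) = 0 at h
    rwa [rho_rho_inv] at h
  obtain ⟨β, ⟨hβ, hpos⟩, hn⟩ := hρ.infinite_positive_roots.exists_notMem_finite
    (Set.finite_iUnion fun i : Fin k => hρ.finite_inversions (w ^ (i : ℕ)))
  have hall : ∀ i < k, IsPos (ρ (w ^ i) β) := by
    intro i hi
    by_contra hneg
    exact hn (Set.mem_iUnion.2 ⟨⟨i, hi⟩, hβ, hpos, (hρ.isPos_neg_iff (hβ.map _)).2 hneg⟩)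
  have h0 := hzero β
  rw [f_apply, Finset.sum_eq_zero_iff_of_nonneg fun i hi =>
    hnonneg _ (hall i (Finset.mem_range.1 hi))] at h0
  have h1 := h0 0 (Finset.mem_range.2 hk1)
  rw [pow_zero, rho_one, ht_apply, Finset.sum_eq_zero_iff_of_nonneg fun t _ => hpos t] at h1
  exact hρ.root_ne_zero hβ (funext fun t => h1 t (Finset.mem_univ t))

end

/-- **Krammer.** In an irreducible Coxeter system with `W` infinite, an element
`w` is essential iff `W` is generated by the reflections `r_β = u s u⁻¹` over all positive
`w`-odd roots `β = u α_s`. -/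
theorem essential_iff_generated_by_odd_reflections
    {M : CoxeterMatrix B} (cs : CoxeterSystem M W)
    (hirr : (coxeterGraph M).Connected) (hinf : Infinite W)
    (ρ : W →* ((B → ℝ) ≃ₗ[ℝ] (B → ℝ)))
    (hρ : ∀ (s : B) (x : B → ℝ), ρ (cs.simple s) x =
      x - (2 * canonicalForm M x (simpleRoot s)) • simpleRoot s)
    (w : W) :
    IsEssential cs w ↔
      Subgroup.closure {t : W | ∃ (u : W) (s : B), t = u * cs.simple s * u⁻¹ ∧
        IsPos (ρ u (simpleRoot s)) ∧ IsWOdd ρ w (ρ u (simpleRoot s))} = ⊤ := by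
  constructor
  · intro hw
    rcases hw.oddSubgroup_eq_top_or hρ hirr with h | ⟨k, hk1, hk⟩
    · exact h
    · exact absurd hw (IsCanonical.not_isEssential_of_pow_eq_one hρ hk hk1)
  · rintro htop _ ⟨v, X, rfl⟩ hne hw
    refine hne (top_le_iff.1 ?_)
    rw [← htop, Subgroup.closure_le]
    rintro _ ⟨u, s, rfl, -, hodd⟩
    rw [← IsCanonical.rootReflection_map_simple hρ]
    exact mem_map_conj_iff.2 (IsCanonical.rootReflection_mem_of_isWOdd hρ (mem_map_conj_iff.1 hw)
      ⟨u, s, rfl⟩ hodd)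

end CoxeterPaper
end
end

section
/- Let (W,S) be an irreducible Coxeter system and let X be a subset of S with ∅ ≠ X ≠ S. Then the standard parabolic subgroup W_X is not a normal subgroup of W. -/
/-!
Statement 7 (Assertion 1): Let (W,S) be an irreducible Coxeter system and let X be a subset
of S with ∅ ≠ X ≠ S. Then the standard parabolic subgroup W_X is not normal in W.
-/

noncomputable section

namespace CoxeterPaper

variable {B : Type*} {W : Type*} [Group W]

/-- The entries `-2 cos(π / m_{s,t})` of the Cartan matrix of `M`. Since `π / 0 = 0`, the
convention `M s t = 0` for `m_{s,t} = ∞` gives the entry `-2`. -/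
def cartanEntry (M : CoxeterMatrix B) (i j : B) : ℝ :=
  -2 * Real.cos (Real.pi / M i j)

theorem cartanEntry_self (M : CoxeterMatrix B) (i : B) : cartanEntry M i i = 2 := by
  simp [cartanEntry]

theorem cartanEntry_comm (M : CoxeterMatrix B) (i j : B) :
    cartanEntry M i j = cartanEntry M j i := by
  rw [cartanEntry, cartanEntry, M.symmetric]

theorem cartanEntry_ne_zero {M : CoxeterMatrix B} {i j : B} (h : M i j = 0 ∨ 3 ≤ M i j) :
    cartanEntry M i j ≠ 0 := by
  have hpos : 0 < Real.cos (Real.pi / M i j) := by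
    rcases h with h | h
    · simp [h]
    · have h3 : (3 : ℝ) ≤ M i j := by exact_mod_cast h
      have hpi := Real.pi_pos
      apply Real.cos_pos_of_mem_Ioo
      constructor
      · have : 0 < Real.pi / M i j := by positivity
        linarith
      · exact div_lt_div_of_pos_left hpi (by norm_num) (by linarith)
  rw [cartanEntry]
  exact mul_ne_zero (by norm_num) hpos.ne'

/-- The simple coroot attached to `i`, as a linear form on the free module on the simple roots. -/
def simpleCoroot (M : CoxeterMatrix B) (i : B) : Module.Dual ℝ (B →₀ ℝ) :=
  Finsupp.linearCombination ℝ (cartanEntry M i)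

theorem simpleCoroot_single (M : CoxeterMatrix B) (i j : B) :
    simpleCoroot M i (Finsupp.single j 1) = cartanEntry M i j := by
  simp [simpleCoroot]

theorem simpleCoroot_self (M : CoxeterMatrix B) (i : B) :
    simpleCoroot M i (Finsupp.single i 1) = 2 := by
  rw [simpleCoroot_single, cartanEntry_self]

/-- The reflection of the geometric representation attached to `i`. -/
def simpleReflection (M : CoxeterMatrix B) (i : B) : (B →₀ ℝ) ≃ₗ[ℝ] (B →₀ ℝ) :=
  Module.reflection (simpleCoroot_self M i)

theorem simpleReflection_apply (M : CoxeterMatrix B) (i : B) (v : B →₀ ℝ) :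
    simpleReflection M i v = v - simpleCoroot M i v • Finsupp.single i 1 :=
  Module.reflection_apply v (simpleCoroot_self M i)

open Polynomial.Chebyshev in
theorem eval_S_of_angle {θ : ℝ} (hθ : Real.sin θ ≠ 0) {k : ℕ} (hk : k * θ = Real.pi) :
    (S ℝ (k - 1)).eval (2 * Real.cos θ) = 0 := by
  have h := S_two_mul_real_cos θ (k - 1)
  push_cast at h
  rw [sub_add_cancel, hk, Real.sin_pi] at h
  exact (mul_eq_zero.mp h).resolve_right hθ

open Polynomial.Chebyshev in
theorem eval_S_add_eval_S_of_angle {θ : ℝ} (hθ : Real.sin θ ≠ 0) {k : ℕ}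
    (hk : (2 * k + 1) * θ = 2 * Real.pi) :
    (S ℝ k).eval (2 * Real.cos θ) + (S ℝ (k - 1)).eval (2 * Real.cos θ) = 0 := by
  have h₁ := S_two_mul_real_cos θ k
  have h₂ := S_two_mul_real_cos θ (k - 1)
  push_cast at h₁ h₂
  have hangle : ((k : ℝ) + 1) * θ = 2 * Real.pi - k * θ := by linear_combination hk
  rw [hangle, Real.sin_two_pi_sub] at h₁
  rw [sub_add_cancel] at h₂
  refine (mul_eq_zero.mp ?_).resolve_right hθ
  rw [add_mul, h₁, h₂, neg_add_cancel]

/-- The product of two reflections has order dividing `m` if the product of their mutual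
pairings is `4 cos²(π / m)`. -/
theorem reflection_mul_reflection_pow_eq_one {V : Type*} [AddCommGroup V] [Module ℝ V]
    {x y : V} {f g : Module.Dual ℝ V} (hf : f x = 2) (hg : g y = 2) {m : ℕ} (hm : 3 ≤ m)
    (h : f y * g x = (2 * Real.cos (Real.pi / m)) ^ 2) :
    (Module.reflection hf * Module.reflection hg) ^ m = 1 := by
  have hm' : (3 : ℝ) ≤ m := by exact_mod_cast hm
  have hm0 : (m : ℝ) ≠ 0 := by linarith
  have hpi := Real.pi_pos
  obtain ⟨θ, hθ⟩ : ∃ θ : ℝ, θ = 2 * Real.pi / m := ⟨_, rfl⟩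
  have hmθ : m * θ = 2 * Real.pi := by rw [hθ]; field_simp
  have hsin : Real.sin θ ≠ 0 := by
    have hpos : 0 < θ := by rw [hθ]; positivity
    refine (Real.sin_pos_of_pos_of_lt_pi hpos ?_).ne'
    nlinarith
  have ht : 2 * Real.cos θ = f y * g x - 2 := by
    have : θ = 2 * (Real.pi / m) := by rw [hθ]; ring
    rw [h, this, Real.cos_two_mul]
    ring
  ext z
  rw [Module.reflection_mul_reflection_pow_apply hf hg m z _ ht]
  obtain ⟨k, rfl | rfl⟩ := m.even_or_odd'
  · have hS := eval_S_of_angle hsin (k := k) (by push_cast at hmθ; linarith)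
    have e₁ : (((2 * k : ℕ) : ℤ) - 2) / 2 = k - 1 := by omega
    have e₂ : (((2 * k : ℕ) : ℤ) - 1) / 2 = k - 1 := by omega
    rw [e₁, e₂, hS]
    simp
  · have hS := eval_S_add_eval_S_of_angle hsin (k := k) (by push_cast at hmθ; exact hmθ)
    have e₁ : (((2 * k + 1 : ℕ) : ℤ) - 2) / 2 = k - 1 := by omega
    have e₂ : (((2 * k + 1 : ℕ) : ℤ) - 1) / 2 = k := by omega
    have e₃ : (((2 * k + 1 : ℕ) : ℤ) - 3) / 2 = k - 1 := by omega
    have e₄ : ((2 * k + 1 : ℕ) : ℤ) / 2 = k := by omega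
    rw [e₁, e₂, e₃, e₄, hS]
    simp

theorem isLiftable_simpleReflection (M : CoxeterMatrix B) : M.IsLiftable (simpleReflection M) := by
  intro i j
  obtain rfl | hij := eq_or_ne i j
  · ext1 v
    rw [M.diagonal, pow_one]
    exact Module.involutive_reflection (simpleCoroot_self M i) v
  have hm1 : M i j ≠ 1 := M.off_diagonal i j hij
  obtain hm | hm | hm : M i j = 0 ∨ M i j = 2 ∨ 3 ≤ M i j := by omega
  · rw [hm, pow_zero]
  · have h₁ : cartanEntry M i j = 0 := by simp [cartanEntry, hm]
    have h₂ : cartanEntry M j i = 0 := by rw [cartanEntry_comm, h₁]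
    ext1 v
    rw [hm, pow_two]
    simp only [LinearEquiv.mul_apply, LinearEquiv.coe_one, id_eq, simpleReflection_apply,
      map_sub, map_smul, simpleCoroot_single, cartanEntry_self, h₁, h₂]
    module
  · refine reflection_mul_reflection_pow_eq_one _ _ hm ?_
    rw [simpleCoroot_single, simpleCoroot_single, cartanEntry_comm M j i, cartanEntry]
    ring

/-- The geometric representation of a Coxeter group. -/
def geometricRepresentation {M : CoxeterMatrix B} (cs : CoxeterSystem M W) :
    W →* ((B →₀ ℝ) ≃ₗ[ℝ] (B →₀ ℝ)) :=
  cs.lift ⟨simpleReflection M, isLiftable_simpleReflection M⟩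

theorem geometricRepresentation_simple {M : CoxeterMatrix B} (cs : CoxeterSystem M W) (i : B) :
    geometricRepresentation cs (cs.simple i) = simpleReflection M i :=
  cs.lift_apply_simple (isLiftable_simpleReflection M) i

/-- Elements of `W_X` do not change the coordinates outside of `X` in the geometric
representation. -/
theorem geometricRepresentation_apply_of_notMem {M : CoxeterMatrix B} (cs : CoxeterSystem M W)
    {X : Set B} {w : W} (hw : w ∈ standardParabolic cs X) {s : B} (hs : s ∉ X) (v : B →₀ ℝ) :
    geometricRepresentation cs w v s = v s := by
  rw [standardParabolic] at hw
  induction hw using Subgroup.closure_induction generalizing v with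
  | mem w hw =>
    obtain ⟨t, ht, rfl⟩ := hw
    have hts : t ≠ s := fun h => hs (h ▸ ht)
    rw [geometricRepresentation_simple, simpleReflection_apply]
    simp [hts]
  | one => simp
  | mul w₁ w₂ _ _ h₁ h₂ => rw [map_mul, LinearEquiv.mul_apply, h₁, h₂]
  | inv w _ h =>
    rw [← h, ← LinearEquiv.mul_apply, ← map_mul, mul_inv_cancel, map_one, LinearEquiv.coe_one, id]

theorem simple_conj_notMem_standardParabolic {M : CoxeterMatrix B} (cs : CoxeterSystem M W)
    {X : Set B} {s t : B} (hs : s ∉ X) (hst : s ≠ t) (hm : M s t = 0 ∨ 3 ≤ M s t) :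
    cs.simple s * cs.simple t * (cs.simple s)⁻¹ ∉ standardParabolic cs X := by
  intro hmem
  have h := geometricRepresentation_apply_of_notMem cs hmem hs (Finsupp.single s 1)
  have hc := cartanEntry_ne_zero hm
  rw [cs.inv_simple, map_mul, map_mul, geometricRepresentation_simple,
    geometricRepresentation_simple] at h
  simp only [LinearEquiv.mul_apply, simpleReflection_apply, map_sub, map_smul,
    simpleCoroot_single, cartanEntry_self, cartanEntry_comm M t s, smul_eq_mul,
    Finsupp.sub_apply, Finsupp.smul_apply, Finsupp.single_eq_same,
    Finsupp.single_eq_of_ne hst] at h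
  apply hc
  nlinarith [mul_self_nonneg (cartanEntry M s t)]

/-- In an irreducible Coxeter system, a standard parabolic subgroup `W_X`
with `∅ ≠ X ≠ S` is not a normal subgroup of `W`. -/
theorem standardParabolic_not_normal [Fintype B] {M : CoxeterMatrix B} (cs : CoxeterSystem M W)
    (hirr : (coxeterGraph M).Connected) (X : Set B) (hne : X.Nonempty) (hproper : X ≠ Set.univ) :
    ¬ (standardParabolic cs X).Normal := by
  intro hN
  obtain ⟨t₀, ht₀⟩ := hne
  obtain ⟨s₀, hs₀⟩ := (Set.ne_univ_iff_exists_notMem X).mp hproper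
  obtain ⟨p⟩ := hirr.preconnected t₀ s₀
  obtain ⟨d, -, ht, hs⟩ := p.exists_boundary_dart X ht₀ hs₀
  obtain ⟨hne, hm⟩ := (SimpleGraph.fromRel_adj _ _ _).mp d.adj
  rw [M.symmetric d.fst, or_self] at hm
  exact simple_conj_notMem_standardParabolic cs hs hne.symm hm
    (hN.conj_mem _ (Subgroup.subset_closure ⟨_, ht, rfl⟩) _)

end CoxeterPaper
end
end

section
/- Let (W,S) be a Coxeter system with set of reflections T = {wsw⁻¹ : s ∈ S, w ∈ W}. Let X ⊆ S, let T_X = {wxw⁻¹ : x ∈ X, w ∈ W}, and let H be the subgroup of W generated by T_X. Then T ∩ H = T_X. -/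
/-!
Statement 9 (Assertion 3): Let (W,S) be a Coxeter system with set of reflections
T = {w s w⁻¹ : s ∈ S, w ∈ W}. Let X ⊆ S, let T_X = {w x w⁻¹ : x ∈ X, w ∈ W}, and let H be the
subgroup of W generated by T_X. Then T ∩ H = T_X.
-/

noncomputable section

namespace CoxeterPaper

variable {B : Type*} {W : Type*} [Group W]

/-- The set of reflections `T = {w s w⁻¹ : s ∈ S, w ∈ W}` of a Coxeter system. -/
def reflections {M : CoxeterMatrix B} (cs : CoxeterSystem M W) : Set W :=
  {t : W | ∃ (w : W) (s : B), t = w * cs.simple s * w⁻¹}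

/-- The set `T_X = {w x w⁻¹ : x ∈ X, w ∈ W}` of reflections along conjugates of elements
of `X ⊆ S`. -/
def reflectionsOf {M : CoxeterMatrix B} (cs : CoxeterSystem M W) (X : Set B) : Set W :=
  {t : W | ∃ (w : W), ∃ x ∈ X, t = w * cs.simple x * w⁻¹}

/-- Simple reflections joined by an odd edge label are conjugate. -/
theorem isConj_simple_of_odd {M : CoxeterMatrix B} (cs : CoxeterSystem M W) {i j : B}
    (h : Odd (M i j)) : IsConj (cs.simple i) (cs.simple j) := by
  obtain ⟨k, hk⟩ := h
  have hinv : cs.simple j * cs.simple i = (cs.simple i * cs.simple j)⁻¹ := by simp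
  have hpow : (cs.simple i * cs.simple j) ^ (2 * k + 1) = 1 :=
    hk ▸ cs.simple_mul_simple_pow i j
  have hcomm : SemiconjBy (cs.simple i) (cs.simple i * cs.simple j)⁻¹
      (cs.simple i * cs.simple j) := by
    rw [← hinv]
    exact (mul_assoc _ _ _).symm
  refine isConj_iff.2 ⟨(cs.simple i * cs.simple j) ^ k, ?_⟩
  calc (cs.simple i * cs.simple j) ^ k * cs.simple i * ((cs.simple i * cs.simple j) ^ k)⁻¹
      = (cs.simple i * cs.simple j) ^ (2 * k) * cs.simple i := by
        rw [← inv_pow, mul_assoc, (hcomm.pow_right k).eq, ← mul_assoc, ← pow_add, two_mul]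
    _ = (cs.simple i * cs.simple j)⁻¹ * cs.simple i := by
        rw [eq_inv_of_mul_eq_one_left ((pow_succ _ _).symm.trans hpow)]
    _ = cs.simple j := by simp

open Classical in
/-- A character of `W` that takes the value `-1` on the simple reflections conjugate to
`cs.simple i` and the value `1` on the other ones. -/
theorem exists_conjugacy_character {M : CoxeterMatrix B} (cs : CoxeterSystem M W) (i : B) :
    ∃ φ : W →* ℤˣ, ∀ j : B,
      φ (cs.simple j) = if IsConj (cs.simple i) (cs.simple j) then -1 else 1 := by
  have hf : M.IsLiftable
      (fun j => if IsConj (cs.simple i) (cs.simple j) then (-1 : ℤˣ) else 1) := by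
    intro j k
    rcases Nat.even_or_odd (M j k) with ⟨n, hn⟩ | hodd
    · rw [hn, ← two_mul, pow_mul, Int.units_sq, one_pow]
    · have hjk := isConj_simple_of_odd cs hodd
      have hiff : IsConj (cs.simple i) (cs.simple j) ↔ IsConj (cs.simple i) (cs.simple k) :=
        ⟨fun h => h.trans hjk, fun h => h.trans hjk.symm⟩
      simp only [hiff, Int.units_mul_self, one_pow]
  exact ⟨cs.lift ⟨_, hf⟩, fun j => cs.lift_apply_simple hf j⟩

/-- If `H` is the subgroup generated by `T_X`, then `T ∩ H = T_X`. -/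
theorem reflections_inter_closure [Fintype B] {M : CoxeterMatrix B} (cs : CoxeterSystem M W)
    (X : Set B) :
    reflections cs ∩ (Subgroup.closure (reflectionsOf cs X) : Set W) = reflectionsOf cs X := by
  refine Set.Subset.antisymm ?_ ?_
  · rintro _ ⟨⟨w, i, rfl⟩, ht⟩
    obtain ⟨φ, hφ⟩ := exists_conjugacy_character cs i
    by_contra hX
    have hker : Subgroup.closure (reflectionsOf cs X) ≤ φ.ker := by
      rw [Subgroup.closure_le]
      rintro _ ⟨v, x, hx, rfl⟩
      have hconj : ¬ IsConj (cs.simple i) (cs.simple x) := fun h => by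
        obtain ⟨c, hc⟩ := isConj_iff.1 h.symm
        exact hX ⟨w * c, x, hx, by rw [← hc]; group⟩
      have hφx : φ (cs.simple x) = 1 := (hφ x).trans (if_neg hconj)
      simp [hφx]
    have hφi : φ (cs.simple i) = -1 := (hφ i).trans (if_pos (IsConj.refl _))
    have h := hker ht
    simp [MonoidHom.mem_ker, hφi] at h
  · rintro _ ⟨w, x, hx, rfl⟩
    exact ⟨⟨w, x, rfl⟩, Subgroup.subset_closure ⟨w, x, hx, rfl⟩⟩

end CoxeterPaper
end
end
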